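/- arXiv:1010.3409 — 2 statements merged into one kernel-verified Lean document; each statement's English description precedes it below -/
import Mathlib

section
/- For a two-dimensional complex Finsler metric on D, the weak symmetry condition R_{r̄kh̄s}η̄^rη̄^hη^s = R_{r̄sh̄k}η̄^rη^sη̄^h (for k ∈ {1,2}) holds at every point of D if and only if δ_s(J̄)·m^s = (1/F)·δ_k(Ō)·η^k − ½·Ō·(J+Y) at every point of D. -/
open Complex

noncomputable section

namespace CFinsler

/-- A point of `T'M` in local coordinates: `(z, η) ∈ ℂⁿ × ℂⁿ`. -/
abbrev Pt (n : ℕ) := (Fin n → ℂ) × (Fin n → ℂ)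

variable {n : ℕ}

/-- Wirtinger derivative `∂f/∂z^k`. -/
def dz (f : Pt n → ℂ) (k : Fin n) (p : Pt n) : ℂ :=
  (1 / 2) * (fderiv ℝ f p ((Pi.single k 1 : Fin n → ℂ), 0) -
    Complex.I * fderiv ℝ f p ((Pi.single k Complex.I : Fin n → ℂ), 0))

/-- Wirtinger derivative `∂f/∂z̄^k`. -/
def dzbar (f : Pt n → ℂ) (k : Fin n) (p : Pt n) : ℂ :=
  (1 / 2) * (fderiv ℝ f p ((Pi.single k 1 : Fin n → ℂ), 0) +
    Complex.I * fderiv ℝ f p ((Pi.single k Complex.I : Fin n → ℂ), 0))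

/-- Wirtinger derivative `∂f/∂η^k`. -/
def de (f : Pt n → ℂ) (k : Fin n) (p : Pt n) : ℂ :=
  (1 / 2) * (fderiv ℝ f p (0, (Pi.single k 1 : Fin n → ℂ)) -
    Complex.I * fderiv ℝ f p (0, (Pi.single k Complex.I : Fin n → ℂ)))

/-- Wirtinger derivative `∂f/∂η̄^k`. -/
def debar (f : Pt n → ℂ) (k : Fin n) (p : Pt n) : ℂ :=
  (1 / 2) * (fderiv ℝ f p (0, (Pi.single k 1 : Fin n → ℂ)) +
    Complex.I * fderiv ℝ f p (0, (Pi.single k Complex.I : Fin n → ℂ)))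

/-- The fundamental metric tensor `g_{i j̄} := ∂²L/∂η^i ∂η̄^j`. -/
def gm (L : Pt n → ℂ) (i j : Fin n) : Pt n → ℂ := de (debar L j) i

/-- `L` is an `n`-dimensional complex Finsler metric on `D`. -/
structure IsCFM (n : ℕ) (D : Set (Pt n)) (L : Pt n → ℂ) : Prop where
  openD : IsOpen D
  fiber_ne : ∀ p ∈ D, p.2 ≠ 0
  conic : ∀ p ∈ D, ∀ lam : ℂ, lam ≠ 0 → (p.1, lam • p.2) ∈ D
  smooth : ContDiffOn ℝ (⊤ : ℕ∞) L D
  real_im : ∀ p ∈ D, (L p).im = 0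
  pos : ∀ p ∈ D, 0 < (L p).re
  homog : ∀ p ∈ D, ∀ lam : ℂ, lam ≠ 0 →
    L (p.1, lam • p.2) = ((Complex.normSq lam : ℝ) : ℂ) * L p
  hermitian : ∀ p ∈ D, ∀ i j, (starRingEnd ℂ) (gm L i j p) = gm L j i p
  posdef : ∀ p ∈ D, ∀ v : Fin n → ℂ, v ≠ 0 →
    0 < (∑ i, ∑ j, gm L i j p * v i * (starRingEnd ℂ) (v j)).re

variable (L : Pt n → ℂ)

/-- The metric tensor as a matrix at a point. -/
def gmat (p : Pt n) : Matrix (Fin n) (Fin n) ℂ := fun i j => gm L i j p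

/-- The inverse metric tensor `g^{l̄ i}`. -/
def gi (l i : Fin n) (p : Pt n) : ℂ := (gmat L p)⁻¹ l i

/-- The Chern–Finsler nonlinear connection coefficients
`N^i_k := g^{m̄ i} (∂g_{l m̄}/∂z^k) η^l`. -/
def Nc (i k : Fin n) (p : Pt n) : ℂ :=
  ∑ m, ∑ l, gi L m i p * dz (gm L l m) k p * p.2 l

/-- The horizontal derivation `δ_k := ∂/∂z^k − N^j_k ∂/∂η^j`. -/
def del (f : Pt n → ℂ) (k : Fin n) (p : Pt n) : ℂ :=
  dz f k p - ∑ j, Nc L j k p * de f j p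

/-- The conjugate horizontal derivation `δ_k̄ := ∂/∂z̄^k − N̄^j_k ∂/∂η̄^j`. -/
def delbar (f : Pt n → ℂ) (k : Fin n) (p : Pt n) : ℂ :=
  dzbar f k p - ∑ j, (starRingEnd ℂ) (Nc L j k p) * debar f j p

/-- The horizontal Chern–Finsler connection coefficients `L^i_{jk} := g^{l̄ i} δ_k(g_{j l̄})`. -/
def Lc (i j k : Fin n) (p : Pt n) : ℂ := ∑ l, gi L l i p * del L (gm L j l) k p

/-- The vertical Chern–Finsler connection coefficients `C^i_{jk} := g^{l̄ i} ∂g_{j l̄}/∂η^k`. -/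
def Cc (i j k : Fin n) (p : Pt n) : ℂ := ∑ l, gi L l i p * de (gm L j l) k p

/-- The spray coefficients `G^i := ½ N^i_j η^j`. -/
def Gs (i : Fin n) (p : Pt n) : ℂ := (1 / 2) * ∑ j, Nc L i j p * p.2 j

/-- The canonical horizontal derivation `δ̊_k := ∂/∂z^k − (∂G^j/∂η^k) ∂/∂η^j`. -/
def delc (f : Pt n → ℂ) (k : Fin n) (p : Pt n) : ℂ :=
  dz f k p - ∑ j, de (Gs L j) k p * de f j p

/-- `F := √L`. -/
def Fh (p : Pt n) : ℂ := (Real.sqrt ((L p).re) : ℂ)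

/-- `l^i := η^i / F`. -/
def lup (i : Fin n) (p : Pt n) : ℂ := p.2 i / Fh L p

/-- `l_i := g_{i j̄} η̄^j / F`. -/
def llow (i : Fin n) (p : Pt n) : ℂ :=
  (∑ j, gm L i j p * (starRingEnd ℂ) (p.2 j)) / Fh L p

/-- `√g` where `g := det(g_{i j̄})`. -/
def sg (p : Pt n) : ℂ := (Real.sqrt ((gmat L p).det.re) : ℂ)

/-- The metric is Kähler. -/
def IsKahler (D : Set (Pt n)) : Prop := ∀ p ∈ D, ∀ i j k, Lc L i j k p = Lc L i k j p

/-- The metric is weakly Kähler. -/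
def IsWeaklyKahler (D : Set (Pt n)) : Prop :=
  ∀ p ∈ D, ∀ k, (∑ i, ∑ j, ∑ l, gm L i l p * (Lc L i j k p - Lc L i k j p) *
    p.2 j * (starRingEnd ℂ) (p.2 l)) = 0

/-- The metric is purely Hermitian: `g_{i j̄}` does not depend on the fibre variable. -/
def IsPurelyHermitian (D : Set (Pt n)) : Prop :=
  ∀ p ∈ D, ∀ i j k, de (gm L i j) k p = 0 ∧ debar (gm L i j) k p = 0

/-- The metric is a complex Berwald metric: Kähler with `L^i_{jk}` independent of the
fibre variable. -/
def IsBerwald (D : Set (Pt n)) : Prop :=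
  IsKahler L D ∧ ∀ p ∈ D, ∀ i j k l, de (Lc L i j k) l p = 0 ∧ debar (Lc L i j k) l p = 0

/-- The metric is a complex Landsberg metric: the Berwald and Rund connections coincide. -/
def IsLandsberg (D : Set (Pt n)) : Prop :=
  ∀ p ∈ D, ∀ i j k, de (de (Gs L i) k) j p =
    (1 / 2) * ∑ l, gi L l i p * (delc L (gm L j l) k p + delc L (gm L k l) j p)

/-- `m^i` of the local complex Berwald frame: `m¹ = −l₂/√g`, `m² = l₁/√g`. -/
def mup (L : Pt 2 → ℂ) (i : Fin 2) (p : Pt 2) : ℂ :=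
  if i = 0 then -(llow L 1 p) / sg L p else llow L 0 p / sg L p

/-- `m_i := g_{i j̄} m̄^j`. -/
def mlow (L : Pt 2 → ℂ) (i : Fin 2) (p : Pt 2) : ℂ :=
  ∑ j, gm L i j p * (starRingEnd ℂ) (mup L j p)

/-- `A := m^j m^k l_h C^h_{kj}`. -/
def sA (L : Pt 2 → ℂ) (p : Pt 2) : ℂ :=
  ∑ j, ∑ k, ∑ h, mup L j p * mup L k p * llow L h p * Cc L h k j p

/-- `B := m_h m^k m^j C^h_{jk}`. -/
def sB (L : Pt 2 → ℂ) (p : Pt 2) : ℂ :=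
  ∑ j, ∑ k, ∑ h, mlow L h p * mup L k p * mup L j p * Cc L h j k p

/-- `J := l^j l^k l_i L^i_{jk}`. -/
def sJ (L : Pt 2 → ℂ) (p : Pt 2) : ℂ :=
  ∑ j, ∑ k, ∑ i, lup L j p * lup L k p * llow L i p * Lc L i j k p

/-- `U := m^j l^k l_i L^i_{jk}`. -/
def sU (L : Pt 2 → ℂ) (p : Pt 2) : ℂ :=
  ∑ j, ∑ k, ∑ i, mup L j p * lup L k p * llow L i p * Lc L i j k p

/-- `V := l^j m^k l_i L^i_{jk}`. -/
def sV (L : Pt 2 → ℂ) (p : Pt 2) : ℂ :=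
  ∑ j, ∑ k, ∑ i, lup L j p * mup L k p * llow L i p * Lc L i j k p

/-- `X := m^j m^k l_i L^i_{jk}`. -/
def sX (L : Pt 2 → ℂ) (p : Pt 2) : ℂ :=
  ∑ j, ∑ k, ∑ i, mup L j p * mup L k p * llow L i p * Lc L i j k p

/-- `O := l^j l^k m_i L^i_{jk}`. -/
def sO (L : Pt 2 → ℂ) (p : Pt 2) : ℂ :=
  ∑ j, ∑ k, ∑ i, lup L j p * lup L k p * mlow L i p * Lc L i j k p

/-- `Y := m^j l^k m_i L^i_{jk}`. -/
def sY (L : Pt 2 → ℂ) (p : Pt 2) : ℂ :=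
  ∑ j, ∑ k, ∑ i, mup L j p * lup L k p * mlow L i p * Lc L i j k p

/-- `E := l^j m^k m_i L^i_{jk}`. -/
def sE (L : Pt 2 → ℂ) (p : Pt 2) : ℂ :=
  ∑ j, ∑ k, ∑ i, lup L j p * mup L k p * mlow L i p * Lc L i j k p

/-- `H := m^j m^k m_i L^i_{jk}`. -/
def sH (L : Pt 2 → ℂ) (p : Pt 2) : ℂ :=
  ∑ j, ∑ k, ∑ i, mup L j p * mup L k p * mlow L i p * Lc L i j k p

/-- The vertical curvature invariant `I := −(∂B/∂η̄^s) m̄^s − B B̄/2`. -/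
def vI (L : Pt 2 → ℂ) (p : Pt 2) : ℂ :=
  -(∑ s, debar (sB L) s p * (starRingEnd ℂ) (mup L s p)) -
    sB L p * (starRingEnd ℂ) (sB L p) / 2

/-- The `v v̄`-Riemann type tensor `S_{r̄ j h̄ k} := −g_{i r̄} ∂C^i_{jk}/∂η̄^h`. -/
def Sv (L : Pt 2 → ℂ) (r j h k : Fin 2) (p : Pt 2) : ℂ :=
  -∑ i, gm L i r p * debar (Cc L i j k) h p

/-- The `h h̄`-Riemann type tensor
`R_{r̄ j h̄ k} := g_{i r̄} (−δ_h̄(L^i_{jk}) − δ_h̄(N^l_k) C^i_{jl})`. -/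
def Rh (L : Pt 2 → ℂ) (r j h k : Fin 2) (p : Pt 2) : ℂ :=
  ∑ i, gm L i r p *
    (-(delbar L (Lc L i j k) h p) - ∑ l, delbar L (Nc L l k) h p * Cc L i j l p)

/-- The horizontal curvature invariant `K := −(1/F) δ_k̄(J) η̄^k`. -/
def hK (L : Pt 2 → ℂ) (p : Pt 2) : ℂ :=
  -(1 / Fh L p) * ∑ k, delbar L (sJ L) k p * (starRingEnd ℂ) (p.2 k)

/-- The horizontal curvature invariant
`W := −δ_s̄(H) m̄^s − ½ H (V̄+H̄) − B F δ_s̄(E) m̄^s`. -/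
def hW (L : Pt 2 → ℂ) (p : Pt 2) : ℂ :=
  -(∑ s, delbar L (sH L) s p * (starRingEnd ℂ) (mup L s p)) -
    (1 / 2) * sH L p * ((starRingEnd ℂ) (sV L p) + (starRingEnd ℂ) (sH L p)) -
    sB L p * Fh L p * ∑ s, delbar L (sE L) s p * (starRingEnd ℂ) (mup L s p)

/-- The weak symmetry condition `R_{0̄ k 0̄ 0} = R_{0̄ 0 0̄ k}`, i.e.
`R_{r̄ k h̄ s} η̄^r η̄^h η^s = R_{r̄ s h̄ k} η̄^r η^s η̄^h`. -/
def WeakSym (L : Pt 2 → ℂ) (D : Set (Pt 2)) : Prop :=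
  ∀ p ∈ D, ∀ k,
    (∑ r, ∑ h, ∑ s, Rh L r k h s p * (starRingEnd ℂ) (p.2 r) *
      (starRingEnd ℂ) (p.2 h) * p.2 s) =
    ∑ r, ∑ s, ∑ h, Rh L r s h k p * (starRingEnd ℂ) (p.2 r) * p.2 s *
      (starRingEnd ℂ) (p.2 h)


/-- Smoothness, in the real sense, on the domain of the metric. -/
def Sm (D : Set (Pt n)) (f : Pt n → ℂ) : Prop := ContDiffOn ℝ (⊤ : ℕ∞) f D

/-- First-order differential operators without zeroth-order term, acting on functions
smooth on `D`. -/
structure IsDer (D : Set (Pt n)) (X : (Pt n → ℂ) → Pt n → ℂ) : Prop where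
  congr : ∀ {f g : Pt n → ℂ}, Set.EqOn f g D → Set.EqOn (X f) (X g) D
  add : ∀ {f g : Pt n → ℂ}, Sm D f → Sm D g → ∀ p ∈ D,
    X (fun q => f q + g q) p = X f p + X g p
  mul : ∀ {f g : Pt n → ℂ}, Sm D f → Sm D g → ∀ p ∈ D,
    X (fun q => f q * g q) p = X f p * g p + f p * X g p
  const : ∀ (c : ℂ), ∀ p ∈ D, X (fun _ => c) p = 0

section Operators

variable {D : Set (Pt n)} {f g : Pt n → ℂ} {X Y : (Pt n → ℂ) → Pt n → ℂ}

lemma Sm.const (c : ℂ) : Sm D (fun _ => c) := contDiffOn_const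

lemma Sm.add (hf : Sm D f) (hg : Sm D g) : Sm D (fun q => f q + g q) :=
  ContDiffOn.add hf hg

lemma Sm.sub (hf : Sm D f) (hg : Sm D g) : Sm D (fun q => f q - g q) :=
  ContDiffOn.sub hf hg

lemma Sm.mul (hf : Sm D f) (hg : Sm D g) : Sm D (fun q => f q * g q) :=
  ContDiffOn.mul hf hg

lemma Sm.sum {ι : Type*} {s : Finset ι} {f : ι → Pt n → ℂ} (hf : ∀ i, Sm D (f i)) :
    Sm D (fun q => ∑ i ∈ s, f i q) :=
  ContDiffOn.sum fun i _ => hf i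

lemma Sm.conj (hf : Sm D f) : Sm D (fun q => (starRingEnd ℂ) (f q)) :=
  conjCLE.contDiff.comp_contDiffOn hf

lemma Sm.inv (hf : Sm D f) (h0 : ∀ p ∈ D, f p ≠ 0) : Sm D (fun q => (f q)⁻¹) :=
  ContDiffOn.inv hf h0

lemma Sm.div (hf : Sm D f) (hg : Sm D g) (h0 : ∀ p ∈ D, g p ≠ 0) :
    Sm D (fun q => f q / g q) := by
  simpa only [div_eq_mul_inv] using hf.mul (hg.inv h0)

lemma Sm.neg (hf : Sm D f) : Sm D (fun q => -f q) := ContDiffOn.neg hf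

lemma Sm.congr (hf : Sm D f) (h : Set.EqOn g f D) : Sm D g := ContDiffOn.congr hf h

lemma Sm.differentiableAt (hD : IsOpen D) (hf : Sm D f) {p : Pt n} (hp : p ∈ D) :
    DifferentiableAt ℝ f p :=
  (ContDiffOn.contDiffAt hf (hD.mem_nhds hp)).differentiableAt (by simp)

lemma Sm.fderiv_apply (hD : IsOpen D) (hf : Sm D f) (v : Pt n) :
    Sm D (fun p => fderiv ℝ f p v) :=
  (ContDiffOn.fderiv_of_isOpen hf hD (m := (⊤ : ℕ∞)) (by simp)).clm_apply contDiffOn_const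

lemma Sm.snd (i : Fin n) : Sm D (fun q : Pt n => q.2 i) :=
  ((contDiff_apply ℝ ℂ i).comp contDiff_snd).contDiffOn

lemma IsDer.sum {ι : Type*} (hX : IsDer D X) {s : Finset ι} {f : ι → Pt n → ℂ}
    (hf : ∀ i, Sm D (f i)) {p : Pt n} (hp : p ∈ D) :
    X (fun q => ∑ i ∈ s, f i q) p = ∑ i ∈ s, X (f i) p := by
  classical
  induction s using Finset.induction_on with
  | empty => simpa using hX.const 0 p hp
  | insert a s ha ih =>
    simp only [Finset.sum_insert ha]
    rw [hX.add (hf a) (Sm.sum hf) p hp, ih]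

lemma IsDer.const_mul (hX : IsDer D X) (c : ℂ) (hf : Sm D f) {p : Pt n} (hp : p ∈ D) :
    X (fun q => c * f q) p = c * X f p := by
  rw [hX.mul (Sm.const c) hf p hp, hX.const c p hp]; ring

lemma IsDer.neg (hX : IsDer D X) (hf : Sm D f) {p : Pt n} (hp : p ∈ D) :
    X (fun q => -f q) p = -X f p := by
  simpa using hX.const_mul (-1) hf hp

lemma IsDer.sub (hX : IsDer D X) (hf : Sm D f) (hg : Sm D g) {p : Pt n} (hp : p ∈ D) :
    X (fun q => f q - g q) p = X f p - X g p := by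
  simp only [sub_eq_add_neg]
  rw [hX.add hf hg.neg p hp, hX.neg hg hp]

lemma IsDer.sum_mul {ι : Type*} [Fintype ι] (hX : IsDer D X) {f g : ι → Pt n → ℂ}
    (hf : ∀ i, Sm D (f i)) (hg : ∀ i, Sm D (g i)) {p : Pt n} (hp : p ∈ D) :
    X (fun q => ∑ i, f i q * g i q) p = ∑ i, (X (f i) p * g i p + f i p * X (g i) p) := by
  rw [hX.sum (fun i => (hf i).mul (hg i)) hp]
  exact Finset.sum_congr rfl fun i _ => hX.mul (hf i) (hg i) p hp

lemma IsDer.smul_add (hX : IsDer D X) (hY : IsDer D Y) (a b : Pt n → ℂ) :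
    IsDer D (fun f p => a p * X f p + b p * Y f p) where
  congr h p hp := by simp only [hX.congr h hp, hY.congr h hp]
  add hf hg p hp := by simp only [hX.add hf hg p hp, hY.add hf hg p hp]; ring
  mul hf hg p hp := by simp only [hX.mul hf hg p hp, hY.mul hf hg p hp]; ring
  const c p hp := by simp only [hX.const c p hp, hY.const c p hp]; ring

lemma IsDer.sum_smul {ι : Type*} [Fintype ι] {X : ι → (Pt n → ℂ) → Pt n → ℂ}
    (hX : ∀ i, IsDer D (X i)) (a : ι → Pt n → ℂ) :
    IsDer D (fun f p => ∑ i, a i p * X i f p) where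
  congr h p hp := Finset.sum_congr rfl fun i _ => by rw [(hX i).congr h hp]
  add hf hg p hp := by
    rw [← Finset.sum_add_distrib]
    exact Finset.sum_congr rfl fun i _ => by rw [(hX i).add hf hg p hp]; ring
  mul hf hg p hp := by
    rw [Finset.sum_mul, Finset.mul_sum, ← Finset.sum_add_distrib]
    exact Finset.sum_congr rfl fun i _ => by rw [(hX i).mul hf hg p hp]; ring
  const c p hp := Finset.sum_eq_zero fun i _ => by rw [(hX i).const c p hp, mul_zero]

/-- Complex combination of two real directional derivatives. -/
def wirt (u v : Pt n) (c : ℂ) (f : Pt n → ℂ) (p : Pt n) : ℂ :=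
  (1 / 2) * fderiv ℝ f p u + c * fderiv ℝ f p v

lemma isDer_fderiv (hD : IsOpen D) (v : Pt n) : IsDer D (fun f p => fderiv ℝ f p v) where
  congr h p hp := by
    simp only
    rw [Filter.EventuallyEq.fderiv_eq (Filter.eventuallyEq_of_mem (hD.mem_nhds hp) h)]
  add hf hg p hp := by
    rw [fderiv_fun_add (hf.differentiableAt hD hp) (hg.differentiableAt hD hp)]; rfl
  mul hf hg p hp := by
    rw [fderiv_fun_mul (hf.differentiableAt hD hp) (hg.differentiableAt hD hp)]
    simp only [add_apply, smul_apply, smul_eq_mul]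
    ring
  const c p _ := by simp

lemma isDer_wirt (hD : IsOpen D) (u v : Pt n) (c : ℂ) : IsDer D (wirt u v c) :=
  (isDer_fderiv hD u).smul_add (isDer_fderiv hD v) (fun _ => 1 / 2) (fun _ => c)

lemma Sm.wirt (hD : IsOpen D) (hf : Sm D f) (u v : Pt n) (c : ℂ) : Sm D (wirt u v c f) :=
  ((Sm.const _).mul (hf.fderiv_apply hD u)).add ((Sm.const _).mul (hf.fderiv_apply hD v))

lemma fderiv_fderiv_comm (hD : IsOpen D) (hf : Sm D f) (u v : Pt n) {p : Pt n} (hp : p ∈ D) :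
    fderiv ℝ (fun q => fderiv ℝ f q u) p v = fderiv ℝ (fun q => fderiv ℝ f q v) p u := by
  have hc := ContDiffOn.contDiffAt hf (hD.mem_nhds hp)
  have hd : DifferentiableAt ℝ (fderiv ℝ f) p :=
    (hc.fderiv_right (m := 1) (by norm_cast)).differentiableAt (by simp)
  have hs : IsSymmSndFDerivAt ℝ f p := hc.isSymmSndFDerivAt (by simp; norm_cast)
  have key (w : Pt n) : fderiv ℝ (fun q => fderiv ℝ f q w) p
      = (fderiv ℝ (fderiv ℝ f) p).flip w := by
    rw [fderiv_clm_apply hd (differentiableAt_const w)]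
    exact ContinuousLinearMap.ext fun x => by simp
  simp only [key, ContinuousLinearMap.flip_apply]
  exact hs v u

lemma wirt_comm (hD : IsOpen D) (hf : Sm D f) (u v u' v' : Pt n) (c c' : ℂ) {p : Pt n}
    (hp : p ∈ D) :
    wirt u v c (wirt u' v' c' f) p = wirt u' v' c' (wirt u v c f) p := by
  have key (w a b : Pt n) (d : ℂ) : fderiv ℝ (wirt a b d f) p w =
      1 / 2 * fderiv ℝ (fun q => fderiv ℝ f q a) p w
        + d * fderiv ℝ (fun q => fderiv ℝ f q b) p w := by
    have hw := isDer_fderiv hD w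
    have ha := hf.fderiv_apply hD a
    have hb := hf.fderiv_apply hD b
    exact (hw.add ((Sm.const (1 / 2)).mul ha) ((Sm.const d).mul hb) p hp).trans
      (congrArg₂ _ (hw.const_mul _ ha hp) (hw.const_mul _ hb hp))
  rw [wirt.eq_1 u v, wirt.eq_1 u' v']
  simp only [key]
  rw [fderiv_fderiv_comm hD hf u' u hp, fderiv_fderiv_comm hD hf v' u hp,
    fderiv_fderiv_comm hD hf u' v hp, fderiv_fderiv_comm hD hf v' v hp]
  ring

lemma dz_eq_wirt (k : Fin n) : (fun f => dz f k) =
    wirt ((Pi.single k 1 : Fin n → ℂ), 0) ((Pi.single k Complex.I : Fin n → ℂ), 0) (-I / 2) := by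
  ext f p; simp only [dz, wirt]; ring

lemma dzbar_eq_wirt (k : Fin n) : (fun f => dzbar f k) =
    wirt ((Pi.single k 1 : Fin n → ℂ), 0) ((Pi.single k Complex.I : Fin n → ℂ), 0) (I / 2) := by
  ext f p; simp only [dzbar, wirt]; ring

lemma de_eq_wirt (k : Fin n) : (fun f => de f k) =
    wirt (0, (Pi.single k 1 : Fin n → ℂ)) (0, (Pi.single k Complex.I : Fin n → ℂ)) (-I / 2) := by
  ext f p; simp only [de, wirt]; ring

lemma debar_eq_wirt (k : Fin n) : (fun f => debar f k) =
    wirt (0, (Pi.single k 1 : Fin n → ℂ)) (0, (Pi.single k Complex.I : Fin n → ℂ)) (I / 2) := by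
  ext f p; simp only [debar, wirt]; ring

lemma isDer_dz (hD : IsOpen D) (k : Fin n) : IsDer D (fun f => dz f k) :=
  dz_eq_wirt k ▸ isDer_wirt hD _ _ _

lemma isDer_dzbar (hD : IsOpen D) (k : Fin n) : IsDer D (fun f => dzbar f k) :=
  dzbar_eq_wirt k ▸ isDer_wirt hD _ _ _

lemma isDer_de (hD : IsOpen D) (k : Fin n) : IsDer D (fun f => de f k) :=
  de_eq_wirt k ▸ isDer_wirt hD _ _ _

lemma isDer_debar (hD : IsOpen D) (k : Fin n) : IsDer D (fun f => debar f k) :=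
  debar_eq_wirt k ▸ isDer_wirt hD _ _ _

lemma Sm.dz (hD : IsOpen D) (hf : Sm D f) (k : Fin n) : Sm D (dz f k) :=
  congrFun (dz_eq_wirt k) f ▸ hf.wirt hD _ _ _

lemma Sm.dzbar (hD : IsOpen D) (hf : Sm D f) (k : Fin n) : Sm D (dzbar f k) :=
  congrFun (dzbar_eq_wirt k) f ▸ hf.wirt hD _ _ _

lemma Sm.de (hD : IsOpen D) (hf : Sm D f) (k : Fin n) : Sm D (de f k) :=
  congrFun (de_eq_wirt k) f ▸ hf.wirt hD _ _ _

lemma Sm.debar (hD : IsOpen D) (hf : Sm D f) (k : Fin n) : Sm D (debar f k) :=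
  congrFun (debar_eq_wirt k) f ▸ hf.wirt hD _ _ _

lemma dz_dzbar_comm (hD : IsOpen D) (hf : Sm D f) (j k : Fin n) {p : Pt n} (hp : p ∈ D) :
    dz (dzbar f k) j p = dzbar (dz f j) k p := by
  have h := wirt_comm hD hf ((Pi.single j 1 : Fin n → ℂ), 0)
    ((Pi.single j Complex.I : Fin n → ℂ), 0) ((Pi.single k 1 : Fin n → ℂ), 0)
    ((Pi.single k Complex.I : Fin n → ℂ), 0) (-I / 2) (I / 2) hp
  simpa only [← dz_eq_wirt, ← dzbar_eq_wirt] using h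

lemma dz_debar_comm (hD : IsOpen D) (hf : Sm D f) (j k : Fin n) {p : Pt n} (hp : p ∈ D) :
    dz (debar f k) j p = debar (dz f j) k p := by
  have h := wirt_comm hD hf ((Pi.single j 1 : Fin n → ℂ), 0)
    ((Pi.single j Complex.I : Fin n → ℂ), 0) (0, (Pi.single k 1 : Fin n → ℂ))
    (0, (Pi.single k Complex.I : Fin n → ℂ)) (-I / 2) (I / 2) hp
  simpa only [← dz_eq_wirt, ← debar_eq_wirt] using h

lemma dzbar_de_comm (hD : IsOpen D) (hf : Sm D f) (j k : Fin n) {p : Pt n} (hp : p ∈ D) :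
    dzbar (de f k) j p = de (dzbar f j) k p := by
  have h := wirt_comm hD hf ((Pi.single j 1 : Fin n → ℂ), 0)
    ((Pi.single j Complex.I : Fin n → ℂ), 0) (0, (Pi.single k 1 : Fin n → ℂ))
    (0, (Pi.single k Complex.I : Fin n → ℂ)) (I / 2) (-I / 2) hp
  simpa only [← dzbar_eq_wirt, ← de_eq_wirt] using h

lemma de_debar_comm (hD : IsOpen D) (hf : Sm D f) (j k : Fin n) {p : Pt n} (hp : p ∈ D) :
    de (debar f k) j p = debar (de f j) k p := by
  have h := wirt_comm hD hf (0, (Pi.single j 1 : Fin n → ℂ))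
    (0, (Pi.single j Complex.I : Fin n → ℂ)) (0, (Pi.single k 1 : Fin n → ℂ))
    (0, (Pi.single k Complex.I : Fin n → ℂ)) (-I / 2) (I / 2) hp
  simpa only [← de_eq_wirt, ← debar_eq_wirt] using h

lemma fderiv_conj_apply (f : Pt n → ℂ) (p v : Pt n) :
    fderiv ℝ (fun q => (starRingEnd ℂ) (f q)) p v = (starRingEnd ℂ) (fderiv ℝ f p v) := by
  have h := conjCLE.comp_fderiv (f := f) (x := p)
  exact congrArg (fun T => T v) h

lemma dz_conj (f : Pt n → ℂ) (k : Fin n) (p : Pt n) :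
    dz (fun q => (starRingEnd ℂ) (f q)) k p = (starRingEnd ℂ) (dzbar f k p) := by
  simp [dz, dzbar, fderiv_conj_apply, map_ofNat (starRingEnd ℂ) 2]; ring

lemma dzbar_conj (f : Pt n → ℂ) (k : Fin n) (p : Pt n) :
    dzbar (fun q => (starRingEnd ℂ) (f q)) k p = (starRingEnd ℂ) (dz f k p) := by
  simp [dz, dzbar, fderiv_conj_apply, map_ofNat (starRingEnd ℂ) 2]

lemma de_conj (f : Pt n → ℂ) (k : Fin n) (p : Pt n) :
    de (fun q => (starRingEnd ℂ) (f q)) k p = (starRingEnd ℂ) (debar f k p) := by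
  simp [de, debar, fderiv_conj_apply, map_ofNat (starRingEnd ℂ) 2]; ring

lemma debar_conj (f : Pt n → ℂ) (k : Fin n) (p : Pt n) :
    debar (fun q => (starRingEnd ℂ) (f q)) k p = (starRingEnd ℂ) (de f k p) := by
  simp [de, debar, fderiv_conj_apply, map_ofNat (starRingEnd ℂ) 2]

lemma fderiv_snd_apply (i : Fin n) (p v : Pt n) :
    fderiv ℝ (fun q : Pt n => q.2 i) p v = v.2 i := by
  have := ((ContinuousLinearMap.proj (R := ℝ) (φ := fun _ : Fin n => ℂ) i).comp
    (ContinuousLinearMap.snd ℝ (Fin n → ℂ) (Fin n → ℂ))).fderiv (x := p)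
  exact congrArg (fun T => T v) this

lemma dz_snd (i k : Fin n) (p : Pt n) : dz (fun q => q.2 i) k p = 0 := by
  simp [dz, fderiv_snd_apply]

lemma dzbar_snd (i k : Fin n) (p : Pt n) : dzbar (fun q => q.2 i) k p = 0 := by
  simp [dzbar, fderiv_snd_apply]

lemma de_snd (i k : Fin n) (p : Pt n) :
    de (fun q => q.2 i) k p = if i = k then 1 else 0 := by
  simp only [de, fderiv_snd_apply, Pi.single_apply]
  split_ifs <;> simp; norm_num

lemma debar_snd (i k : Fin n) (p : Pt n) : debar (fun q => q.2 i) k p = 0 := by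
  simp only [debar, fderiv_snd_apply, Pi.single_apply]
  split_ifs <;> simp

lemma fderiv_fiber (f : Pt n → ℂ) (p : Pt n) (w : Fin n → ℂ) :
    fderiv ℝ f p (0, w) = ∑ k, (de f k p * w k + debar f k p * (starRingEnd ℂ) (w k)) := by
  have hw : ((0, w) : Pt n) = ∑ k, ((w k).re • ((0, Pi.single k 1) : Pt n)
      + (w k).im • ((0, Pi.single k I) : Pt n)) := by
    ext j
    · simp [Prod.fst_sum]
    · simp [Prod.snd_sum, Finset.sum_apply, Pi.single_apply, Finset.sum_add_distrib]
  rw [hw, map_sum]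
  refine Finset.sum_congr rfl fun k _ => ?_
  rw [map_add, map_smul, map_smul, real_smul, real_smul]
  simp only [de, debar]
  generalize fderiv ℝ f p (0, Pi.single k 1) = a
  generalize fderiv ℝ f p (0, Pi.single k I) = b
  conv_rhs => rw [← re_add_im (w k)]
  simp only [map_add, map_mul, conj_ofReal, conj_I]
  linear_combination ((w k).im * b) * I_sq

end Operators

section Finsler

variable {D : Set (Pt 2)} {L : Pt 2 → ℂ}

section Smoothness

lemma IsCFM.sm (hL : IsCFM 2 D L) : Sm D L := hL.smooth

lemma IsCFM.sm_gm (hL : IsCFM 2 D L) (i j : Fin 2) : Sm D (gm L i j) :=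
  (hL.sm.debar hL.openD j).de hL.openD i

lemma gmat_det (L : Pt 2 → ℂ) (p : Pt 2) :
    (gmat L p).det = gm L 0 0 p * gm L 1 1 p - gm L 0 1 p * gm L 1 0 p := by
  rw [Matrix.det_fin_two]; rfl

lemma IsCFM.gmat_det_conj (hL : IsCFM 2 D L) {p : Pt 2} (hp : p ∈ D) :
    (starRingEnd ℂ) (gmat L p).det = (gmat L p).det := by
  simp only [gmat_det, map_sub, map_mul, hL.hermitian p hp]
  ring

lemma IsCFM.gmat_det_pos (hL : IsCFM 2 D L) {p : Pt 2} (hp : p ∈ D) :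
    0 < (gmat L p).det.re := by
  have h0 := hL.posdef p hp ![1, 0] (by simp)
  simp only [Fin.sum_univ_two, Matrix.cons_val_zero, Matrix.cons_val_one, map_one, map_zero,
    mul_one, mul_zero, add_zero] at h0
  have hv : (![-gm L 1 0 p, gm L 0 0 p] : Fin 2 → ℂ) ≠ 0 := by
    intro h
    have h1 : gm L 0 0 p = 0 := by simpa using congrFun h 1
    simp [h1] at h0
  have h1 := hL.posdef p hp _ hv
  simp only [Fin.sum_univ_two, Matrix.cons_val_zero, Matrix.cons_val_one, map_neg,
    hL.hermitian p hp] at h1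
  have h2 : gm L 0 0 p * -gm L 1 0 p * -gm L 0 1 p + gm L 0 1 p * -gm L 1 0 p * gm L 0 0 p
      + (gm L 1 0 p * gm L 0 0 p * -gm L 0 1 p + gm L 1 1 p * gm L 0 0 p * gm L 0 0 p)
      = gm L 0 0 p * (gmat L p).det := by rw [gmat_det]; ring
  rw [h2, mul_re, conj_eq_iff_im.mp (hL.gmat_det_conj hp), mul_zero, sub_zero] at h1
  exact pos_of_mul_pos_right h1 (by simpa using h0.le)

lemma IsCFM.gmat_det_ne (hL : IsCFM 2 D L) {p : Pt 2} (hp : p ∈ D) : (gmat L p).det ≠ 0 := by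
  intro h
  simpa [h] using hL.gmat_det_pos hp

lemma IsCFM.sm_det (hL : IsCFM 2 D L) : Sm D (fun p => (gmat L p).det) := by
  simp only [gmat_det]
  exact ((hL.sm_gm 0 0).mul (hL.sm_gm 1 1)).sub ((hL.sm_gm 0 1).mul (hL.sm_gm 1 0))

lemma IsCFM.sm_gi (hL : IsCFM 2 D L) (l i : Fin 2) : Sm D (gi L l i) := by
  have h : gi L l i = fun p => (gmat L p).det⁻¹ * (gmat L p).adjugate l i := by
    ext p
    simp [gi, Matrix.inv_def, Matrix.smul_apply]
  rw [h]
  refine (hL.sm_det.inv fun p hp => hL.gmat_det_ne hp).mul ?_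
  simp only [Matrix.adjugate_fin_two]
  fin_cases l <;> fin_cases i
  · exact hL.sm_gm 1 1
  · exact (hL.sm_gm 0 1).neg
  · exact (hL.sm_gm 1 0).neg
  · exact hL.sm_gm 0 0

lemma IsCFM.sm_Nc (hL : IsCFM 2 D L) (i k : Fin 2) : Sm D (Nc L i k) :=
  Sm.sum fun m => Sm.sum fun l =>
    ((hL.sm_gi m i).mul ((hL.sm_gm l m).dz hL.openD k)).mul (Sm.snd l)

lemma IsCFM.sm_del (hL : IsCFM 2 D L) {f : Pt 2 → ℂ} (hf : Sm D f) (k : Fin 2) :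
    Sm D (del L f k) :=
  (hf.dz hL.openD k).sub (Sm.sum fun j => (hL.sm_Nc j k).mul (hf.de hL.openD j))

lemma IsCFM.sm_Lc (hL : IsCFM 2 D L) (i j k : Fin 2) : Sm D (Lc L i j k) :=
  Sm.sum fun l => (hL.sm_gi l i).mul (hL.sm_del (hL.sm_gm j l) k)

lemma sm_ofReal_sqrt {f : Pt 2 → ℂ} (hf : Sm D f) (h0 : ∀ p ∈ D, 0 < (f p).re) :
    Sm D (fun p => (Real.sqrt (f p).re : ℂ)) := by
  have h := ContDiffOn.sqrt (reCLM.contDiff.comp_contDiffOn hf) fun p hp => (h0 p hp).ne'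
  exact ofRealCLM.contDiff.comp_contDiffOn h

lemma IsCFM.sm_Fh (hL : IsCFM 2 D L) : Sm D (Fh L) := sm_ofReal_sqrt hL.sm hL.pos

lemma IsCFM.sm_sg (hL : IsCFM 2 D L) : Sm D (sg L) :=
  sm_ofReal_sqrt hL.sm_det fun _ hp => hL.gmat_det_pos hp

lemma ofReal_sqrt_mul_self {w : ℂ} (h0 : 0 < w.re) (him : w.im = 0) :
    (Real.sqrt w.re : ℂ) * Real.sqrt w.re = w := by
  rw [← ofReal_mul, Real.mul_self_sqrt h0.le]
  exact Complex.ext (by simp) (by simp [him])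

lemma IsCFM.Fh_mul_self (hL : IsCFM 2 D L) {p : Pt 2} (hp : p ∈ D) : Fh L p * Fh L p = L p :=
  ofReal_sqrt_mul_self (hL.pos p hp) (hL.real_im p hp)

lemma IsCFM.sg_mul_self (hL : IsCFM 2 D L) {p : Pt 2} (hp : p ∈ D) :
    sg L p * sg L p = (gmat L p).det :=
  ofReal_sqrt_mul_self (hL.gmat_det_pos hp) (conj_eq_iff_im.mp (hL.gmat_det_conj hp))

lemma IsCFM.Fh_ne (hL : IsCFM 2 D L) {p : Pt 2} (hp : p ∈ D) : Fh L p ≠ 0 :=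
  ofReal_ne_zero.mpr (Real.sqrt_pos.mpr (hL.pos p hp)).ne'

lemma IsCFM.sg_ne (hL : IsCFM 2 D L) {p : Pt 2} (hp : p ∈ D) : sg L p ≠ 0 :=
  ofReal_ne_zero.mpr (Real.sqrt_pos.mpr (hL.gmat_det_pos hp)).ne'

lemma conj_Fh (L : Pt 2 → ℂ) (p : Pt 2) : (starRingEnd ℂ) (Fh L p) = Fh L p := conj_ofReal _

lemma conj_sg (L : Pt 2 → ℂ) (p : Pt 2) : (starRingEnd ℂ) (sg L p) = sg L p := conj_ofReal _

end Smoothness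

section Euler

lemma IsCFM.conj_apply (hL : IsCFM 2 D L) {p : Pt 2} (hp : p ∈ D) :
    (starRingEnd ℂ) (L p) = L p :=
  conj_eq_iff_im.mpr (hL.real_im p hp)

lemma IsCFM.fderiv_radial (hL : IsCFM 2 D L) {p : Pt 2} (hp : p ∈ D) (c : ℂ) :
    fderiv ℝ L p (0, c • p.2) = 2 * c.re * L p := by
  have hcurve : HasDerivAt (fun t : ℝ => ((p.1, (1 + (t : ℂ) * c) • p.2) : Pt 2))
      (0, c • p.2) 0 := by
    refine (hasDerivAt_const (0 : ℝ) p.1).prodMk ?_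
    have h1 : HasDerivAt (fun t : ℝ => 1 + (t : ℂ) * c) c 0 := by
      simpa using ((ofRealCLM.hasDerivAt (x := (0 : ℝ))).mul_const c).const_add 1
    exact h1.smul_const p.2
  have hfd : HasFDerivAt L (fderiv ℝ L p) ((p.1, (1 + ((0 : ℝ) : ℂ) * c) • p.2) : Pt 2) := by
    simpa using (hL.sm.differentiableAt hL.openD hp).hasFDerivAt
  have h1 := hfd.comp_hasDerivAt (0 : ℝ) hcurve
  have h2 : HasDerivAt (fun t : ℝ => (((1 + t * c.re) * (1 + t * c.re)
      + t * c.im * (t * c.im) : ℝ) : ℂ) * L p) (((2 * c.re : ℝ) : ℂ) * L p) 0 := by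
    have ha : HasDerivAt (fun t : ℝ => 1 + t * c.re) c.re 0 := by
      simpa using ((hasDerivAt_id (0 : ℝ)).mul_const c.re).const_add 1
    have hb : HasDerivAt (fun t : ℝ => t * c.im) c.im 0 := by
      simpa using (hasDerivAt_id (0 : ℝ)).mul_const c.im
    have hab := ((ha.mul ha).add (hb.mul hb)).ofReal_comp.mul_const (L p)
    refine hab.congr_deriv ?_
    simp
    left
    ring
  have hne : ∀ᶠ t : ℝ in nhds 0, 1 + (t : ℂ) * c ≠ 0 := by
    have hc : ContinuousAt (fun t : ℝ => 1 + (t : ℂ) * c) 0 := by fun_prop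
    exact hc.eventually_ne (by simp)
  have heq : (L ∘ fun t : ℝ => ((p.1, (1 + (t : ℂ) * c) • p.2) : Pt 2)) =ᶠ[nhds 0]
      fun t : ℝ => (((1 + t * c.re) * (1 + t * c.re)
      + t * c.im * (t * c.im) : ℝ) : ℂ) * L p := by
    filter_upwards [hne] with t ht
    simp [hL.homog p hp _ ht, normSq_apply]
  rw [(h1.congr_of_eventuallyEq heq.symm).unique h2]
  push_cast
  ring

lemma IsCFM.euler (hL : IsCFM 2 D L) {p : Pt 2} (hp : p ∈ D) :
    ∑ i, de L i p * p.2 i = L p ∧ ∑ i, debar L i p * (starRingEnd ℂ) (p.2 i) = L p := by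
  have h1 := hL.fderiv_radial hp 1
  have h2 := hL.fderiv_radial hp I
  rw [fderiv_fiber] at h1 h2
  simp only [Fin.sum_univ_two, Pi.smul_apply, smul_eq_mul, map_mul, conj_I, one_re, I_re,
    ofReal_one, ofReal_zero, map_one] at h1 h2 ⊢
  constructor
  · linear_combination (1 / 2) * h1 - (I / 2) * h2 + (1 / 2) * (de L 0 p * p.2 0
      + de L 1 p * p.2 1 - debar L 0 p * (starRingEnd ℂ) (p.2 0)
      - debar L 1 p * (starRingEnd ℂ) (p.2 1)) * I_sq
  · linear_combination (1 / 2) * h1 + (I / 2) * h2 - (1 / 2) * (de L 0 p * p.2 0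
      + de L 1 p * p.2 1 - debar L 0 p * (starRingEnd ℂ) (p.2 0)
      - debar L 1 p * (starRingEnd ℂ) (p.2 1)) * I_sq

lemma IsCFM.de_eq_conj (hL : IsCFM 2 D L) (i : Fin 2) :
    Set.EqOn (de L i) (fun q => (starRingEnd ℂ) (debar L i q)) D := fun p hp => by
  have h := (isDer_de hL.openD i).congr (f := L) (g := fun q => (starRingEnd ℂ) (L q))
    (fun q hq => (hL.conj_apply hq).symm) hp
  simpa only [de_conj] using h

lemma IsCFM.dzbar_eq_conj (hL : IsCFM 2 D L) (i : Fin 2) :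
    Set.EqOn (dzbar L i) (fun q => (starRingEnd ℂ) (dz L i q)) D := fun p hp => by
  have h := (isDer_dzbar hL.openD i).congr (f := L) (g := fun q => (starRingEnd ℂ) (L q))
    (fun q hq => (hL.conj_apply hq).symm) hp
  simpa only [dzbar_conj] using h

lemma IsCFM.debar_de (hL : IsCFM 2 D L) (i m : Fin 2) {p : Pt 2} (hp : p ∈ D) :
    debar (de L i) m p = gm L i m p :=
  (de_debar_comm hL.openD hL.sm i m hp).symm

lemma IsCFM.sum_gm_mul (hL : IsCFM 2 D L) (m : Fin 2) {p : Pt 2} (hp : p ∈ D) :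
    ∑ l, gm L l m p * p.2 l = debar L m p := by
  have hX := isDer_debar hL.openD m
  have h := hX.congr (fun q hq => (hL.euler hq).1) hp
  rw [← h, hX.sum_mul (fun i => hL.sm.de hL.openD i) Sm.snd hp]
  simp [debar_snd, hL.debar_de _ _ hp]

lemma IsCFM.sum_gm_mul_conj (hL : IsCFM 2 D L) (i : Fin 2) {p : Pt 2} (hp : p ∈ D) :
    ∑ m, gm L i m p * (starRingEnd ℂ) (p.2 m) = de L i p := by
  have hX := isDer_de hL.openD i
  have h := hX.congr (fun q hq => (hL.euler hq).2) hp
  rw [← h, hX.sum_mul (fun i => hL.sm.debar hL.openD i) (fun i => (Sm.snd i).conj) hp]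
  simp [de_conj, debar_snd, gm]

lemma IsCFM.sum_de_gm_mul (hL : IsCFM 2 D L) (l s : Fin 2) {p : Pt 2} (hp : p ∈ D) :
    ∑ j, de (gm L j l) s p * p.2 j = 0 := by
  have hX := isDer_de hL.openD s
  have h := hX.congr (fun q hq => hL.sum_gm_mul l hq) hp
  rw [hX.sum_mul (fun j => hL.sm_gm j l) Sm.snd hp, Finset.sum_add_distrib] at h
  simpa [de_snd, gm] using h

end Euler

section Connection

lemma IsCFM.isDer_del (hL : IsCFM 2 D L) (k : Fin 2) : IsDer D (fun f => del L f k) := by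
  have h := (isDer_dz hL.openD k).smul_add
    (IsDer.sum_smul (fun j => isDer_de hL.openD j) (fun j => Nc L j k)) (fun _ => 1) (fun _ => -1)
  simp only [one_mul, neg_one_mul, ← sub_eq_add_neg] at h
  exact h

lemma IsCFM.isDer_delbar (hL : IsCFM 2 D L) (k : Fin 2) : IsDer D (fun f => delbar L f k) := by
  have h := (isDer_dzbar hL.openD k).smul_add
    (IsDer.sum_smul (fun j => isDer_debar hL.openD j) (fun j p => (starRingEnd ℂ) (Nc L j k p)))
    (fun _ => 1) (fun _ => -1)
  simp only [one_mul, neg_one_mul, ← sub_eq_add_neg] at h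
  exact h

lemma del_conj (L f : Pt 2 → ℂ) (k : Fin 2) (p : Pt 2) :
    del L (fun q => (starRingEnd ℂ) (f q)) k p = (starRingEnd ℂ) (delbar L f k p) := by
  simp [del, delbar, dz_conj, de_conj]

lemma delbar_conj (L f : Pt 2 → ℂ) (k : Fin 2) (p : Pt 2) :
    delbar L (fun q => (starRingEnd ℂ) (f q)) k p = (starRingEnd ℂ) (del L f k p) := by
  simp [del, delbar, dzbar_conj, debar_conj]

lemma delbar_snd (L : Pt 2 → ℂ) (i k : Fin 2) (p : Pt 2) :
    delbar L (fun q => q.2 i) k p = 0 := by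
  simp [delbar, dzbar_snd, debar_snd]

lemma del_conj_snd (L : Pt 2 → ℂ) (i k : Fin 2) (p : Pt 2) :
    del L (fun q => (starRingEnd ℂ) (q.2 i)) k p = 0 := by
  rw [del_conj L (fun q => q.2 i), delbar_snd, map_zero]

lemma IsCFM.sum_gi_mul_gm (hL : IsCFM 2 D L) (l m : Fin 2) {p : Pt 2} (hp : p ∈ D) :
    ∑ i, gi L l i p * gm L i m p = if l = m then 1 else 0 := by
  have h := Matrix.nonsing_inv_mul (gmat L p) (isUnit_iff_ne_zero.mpr (hL.gmat_det_ne hp))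
  have h' := congrFun (congrFun h l) m
  rw [Matrix.mul_apply, Matrix.one_apply] at h'
  exact h'

lemma IsCFM.sum_gm_mul_raise (hL : IsCFM 2 D L) (y : Fin 2 → ℂ) (m : Fin 2) {p : Pt 2}
    (hp : p ∈ D) : ∑ i, gm L i m p * ∑ l, gi L l i p * y l = y m := by
  have h0 := hL.sum_gi_mul_gm 0 m hp
  have h1 := hL.sum_gi_mul_gm 1 m hp
  have h2 : y m = (if 0 = m then 1 else 0) * y 0 + (if 1 = m then 1 else 0) * y 1 := by
    fin_cases m <;> simp
  rw [h2, ← h0, ← h1]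
  simp only [Fin.sum_univ_two]
  ring

lemma IsCFM.sum_gm_mul_Nc (hL : IsCFM 2 D L) (m k : Fin 2) {p : Pt 2} (hp : p ∈ D) :
    ∑ i, gm L i m p * Nc L i k p = ∑ l, dz (gm L l m) k p * p.2 l := by
  rw [← hL.sum_gm_mul_raise (fun m => ∑ l, dz (gm L l m) k p * p.2 l) m hp]
  simp only [Nc, Finset.mul_sum, mul_assoc]

lemma IsCFM.sum_gm_mul_Lc (hL : IsCFM 2 D L) (j l k : Fin 2) {p : Pt 2} (hp : p ∈ D) :
    ∑ i, gm L i l p * Lc L i j k p = del L (gm L j l) k p :=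
  hL.sum_gm_mul_raise (fun l => del L (gm L j l) k p) l hp

lemma IsCFM.sum_gm_mul_Cc (hL : IsCFM 2 D L) (j l k : Fin 2) {p : Pt 2} (hp : p ∈ D) :
    ∑ i, gm L i l p * Cc L i j k p = de (gm L j l) k p :=
  hL.sum_gm_mul_raise (fun l => de (gm L j l) k p) l hp

lemma IsCFM.sum_Lc_mul (hL : IsCFM 2 D L) (i k : Fin 2) {p : Pt 2} (hp : p ∈ D) :
    ∑ j, Lc L i j k p * p.2 j = Nc L i k p := by
  have h (l s : Fin 2) := hL.sum_de_gm_mul l s hp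
  simp only [Fin.sum_univ_two] at h
  rw [Nc.eq_1]
  simp only [Lc, del, Fin.sum_univ_two]
  linear_combination (-gi L 0 i p * Nc L 0 k p) * h 0 0 - gi L 0 i p * Nc L 1 k p * h 0 1
    - gi L 1 i p * Nc L 0 k p * h 1 0 - gi L 1 i p * Nc L 1 k p * h 1 1

lemma IsCFM.dz_debar (hL : IsCFM 2 D L) (m k : Fin 2) {p : Pt 2} (hp : p ∈ D) :
    dz (debar L m) k p = ∑ i, gm L i m p * Nc L i k p := by
  have hX := isDer_dz hL.openD k
  have h := hX.congr (fun q hq => hL.sum_gm_mul m hq) hp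
  rw [hL.sum_gm_mul_Nc m k hp, ← h, hX.sum_mul (fun l => hL.sm_gm l m) Sm.snd hp]
  simp [dz_snd]

lemma IsCFM.del_debar (hL : IsCFM 2 D L) (m k : Fin 2) {p : Pt 2} (hp : p ∈ D) :
    del L (debar L m) k p = 0 := by
  rw [del, hL.dz_debar m k hp, sub_eq_zero]
  exact Finset.sum_congr rfl fun i _ => mul_comm _ _

lemma IsCFM.delbar_de (hL : IsCFM 2 D L) (m k : Fin 2) {p : Pt 2} (hp : p ∈ D) :
    delbar L (de L m) k p = 0 := by
  have h := (hL.isDer_delbar k).congr (hL.de_eq_conj m) hp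
  simpa only [delbar_conj, hL.del_debar m k hp, map_zero] using h

lemma IsCFM.del_self (hL : IsCFM 2 D L) (k : Fin 2) {p : Pt 2} (hp : p ∈ D) :
    del L L k p = 0 := by
  have hX := hL.isDer_del k
  have h := hX.congr (fun q hq => (hL.euler hq).2) hp
  rw [← h, hX.sum_mul (fun i => hL.sm.debar hL.openD i) (fun i => (Sm.snd i).conj) hp]
  simp [del_conj_snd, hL.del_debar _ _ hp]

lemma IsCFM.dz_self (hL : IsCFM 2 D L) (k : Fin 2) {p : Pt 2} (hp : p ∈ D) :
    dz L k p = ∑ j, Nc L j k p * de L j p :=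
  sub_eq_zero.mp (hL.del_self k hp)

lemma IsCFM.delbar_del_comm (hL : IsCFM 2 D L) {f : Pt 2 → ℂ} (hf : Sm D f) (h s : Fin 2)
    {p : Pt 2} (hp : p ∈ D) :
    delbar L (del L f s) h p + ∑ l, delbar L (Nc L l s) h p * de f l p =
      del L (delbar L f h) s p
        + ∑ l, del L (fun q => (starRingEnd ℂ) (Nc L l h q)) s p * debar f l p := by
  have hD := hL.openD
  have h1 : delbar L (del L f s) h p = delbar L (dz f s) h p
      - ∑ l, (delbar L (Nc L l s) h p * de f l p + Nc L l s p * delbar L (de f l) h p) := by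
    have hX := hL.isDer_delbar h
    rw [← hX.sum_mul (fun l => hL.sm_Nc l s) (fun l => hf.de hD l) hp]
    exact hX.sub (hf.dz hD s) (Sm.sum fun l => (hL.sm_Nc l s).mul (hf.de hD l)) hp
  have h2 : del L (delbar L f h) s p = del L (dzbar f h) s p
      - ∑ l, (del L (fun q => (starRingEnd ℂ) (Nc L l h q)) s p * debar f l p
        + (starRingEnd ℂ) (Nc L l h p) * del L (debar f l) s p) := by
    have hX := hL.isDer_del s
    rw [← hX.sum_mul (fun l => (hL.sm_Nc l h).conj) (fun l => hf.debar hD l) hp]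
    exact hX.sub (hf.dzbar hD h)
      (Sm.sum fun l => (hL.sm_Nc l h).conj.mul (hf.debar hD l)) hp
  have h3 : delbar L (dz f s) h p - ∑ l, Nc L l s p * delbar L (de f l) h p =
      del L (dzbar f h) s p - ∑ l, (starRingEnd ℂ) (Nc L l h p) * del L (debar f l) s p := by
    simp only [del, delbar, Fin.sum_univ_two, dz_dzbar_comm hD hf s h hp,
      dzbar_de_comm hD hf h _ hp, dz_debar_comm hD hf s _ hp, de_debar_comm hD hf _ _ hp]
    ring
  rw [h1, h2, Finset.sum_add_distrib, Finset.sum_add_distrib]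
  linear_combination h3

end Connection

section Curvature

lemma IsCFM.sum_de_mul_Lc (hL : IsCFM 2 D L) (j k : Fin 2) {p : Pt 2} (hp : p ∈ D) :
    ∑ i, de L i p * Lc L i j k p = del L (de L j) k p := by
  have hX := hL.isDer_del k
  have h := hX.congr (fun q hq => hL.sum_gm_mul_conj j hq) hp
  rw [← h, hX.sum_mul (fun m => hL.sm_gm j m) (fun m => (Sm.snd m).conj) hp]
  simp only [del_conj_snd, ← hL.sum_gm_mul_Lc _ _ _ hp, ← hL.sum_gm_mul_conj _ hp,
    Fin.sum_univ_two]
  ring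

lemma IsCFM.sum_de_mul_Cc (hL : IsCFM 2 D L) (j k : Fin 2) {p : Pt 2} (hp : p ∈ D) :
    ∑ i, de L i p * Cc L i j k p = de (de L j) k p := by
  have hX := isDer_de hL.openD k
  have h := hX.congr (fun q hq => hL.sum_gm_mul_conj j hq) hp
  rw [← h, hX.sum_mul (fun m => hL.sm_gm j m) (fun m => (Sm.snd m).conj) hp]
  simp only [de_conj, debar_snd, ← hL.sum_gm_mul_Cc _ _ _ hp, ← hL.sum_gm_mul_conj _ hp,
    Fin.sum_univ_two, map_zero]
  ring

lemma IsCFM.delbar_del_de (hL : IsCFM 2 D L) (j k h : Fin 2) {p : Pt 2} (hp : p ∈ D) :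
    delbar L (del L (de L j) k) h p = ∑ i, de L i p * delbar L (Lc L i j k) h p := by
  have hX := hL.isDer_delbar h
  rw [← hX.congr (fun q hq => hL.sum_de_mul_Lc j k hq) hp,
    hX.sum_mul (fun i => hL.sm.de hL.openD i) (fun i => hL.sm_Lc i j k) hp]
  simp [hL.delbar_de _ _ hp]

lemma IsCFM.sum_Rh_mul_conj (hL : IsCFM 2 D L) (j h k : Fin 2) {p : Pt 2} (hp : p ∈ D) :
    ∑ r, Rh L r j h k p * (starRingEnd ℂ) (p.2 r) =
      -∑ l, gm L j l p * del L (fun q => (starRingEnd ℂ) (Nc L l h q)) k p := by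
  have h1 := hL.delbar_del_comm (hL.sm.de hL.openD j) h k hp
  have h2 : del L (delbar L (de L j) h) k p = 0 := by
    rw [(hL.isDer_del k).congr (g := fun _ => 0) (fun q hq => hL.delbar_de j h hq) hp]
    exact (hL.isDer_del k).const 0 p hp
  simp only [h2, hL.delbar_del_de j k h hp, hL.debar_de _ _ hp, ← hL.sum_de_mul_Cc _ _ hp,
    ← hL.sum_gm_mul_conj _ hp, Fin.sum_univ_two] at h1
  simp only [Rh, Fin.sum_univ_two]
  linear_combination -h1

lemma IsCFM.sum_debar_mul_del_conj_Nc (hL : IsCFM 2 D L) (h k : Fin 2) {p : Pt 2}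
    (hp : p ∈ D) :
    ∑ l, debar L l p * del L (fun q => (starRingEnd ℂ) (Nc L l h q)) k p =
      del L (dzbar L h) k p := by
  have hX := hL.isDer_del k
  have he : Set.EqOn (dzbar L h)
      (fun q => ∑ l, debar L l q * (starRingEnd ℂ) (Nc L l h q)) D := fun q hq => by
    simp only [hL.dzbar_eq_conj h hq, hL.dz_self h hq, map_sum, map_mul]
    refine Finset.sum_congr rfl fun l _ => ?_
    rw [hL.de_eq_conj l hq, conj_conj, mul_comm]
  rw [hX.congr he hp,
    hX.sum_mul (fun l => hL.sm.debar hL.openD l) (fun l => (hL.sm_Nc l h).conj) hp]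
  simp [hL.del_debar _ _ hp]

end Curvature

section Frame

lemma IsCFM.llow_eq (hL : IsCFM 2 D L) (i : Fin 2) {p : Pt 2} (hp : p ∈ D) :
    llow L i p = de L i p / Fh L p := by
  rw [llow, hL.sum_gm_mul_conj i hp]

lemma IsCFM.sum_mup_mul_gm (hL : IsCFM 2 D L) (l : Fin 2) {p : Pt 2} (hp : p ∈ D) :
    ∑ k, mup L k p * gm L k l p = (starRingEnd ℂ) (mlow L l p) := by
  simp only [mlow, map_sum, map_mul, conj_conj, hL.hermitian p hp]
  exact Finset.sum_congr rfl fun k _ => mul_comm _ _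

lemma IsCFM.mlow_eq (hL : IsCFM 2 D L) {p : Pt 2} (hp : p ∈ D) :
    mlow L 0 p = -(sg L p * p.2 1) / Fh L p ∧ mlow L 1 p = sg L p * p.2 0 / Fh L p := by
  have hF := hL.Fh_ne hp
  have hs := hL.sg_ne hp
  have hd := hL.sg_mul_self hp
  rw [gmat_det] at hd
  simp only [mlow, mup, llow, Fin.sum_univ_two, map_div₀, map_neg, map_add, map_mul, conj_conj,
    conj_Fh, conj_sg, hL.hermitian p hp, one_ne_zero, if_true, if_false]
  constructor
  · field_simp
    linear_combination p.2 1 * hd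
  · field_simp
    linear_combination -p.2 0 * hd

lemma IsCFM.del_Fh (hL : IsCFM 2 D L) (k : Fin 2) {p : Pt 2} (hp : p ∈ D) :
    del L (Fh L) k p = 0 := by
  have hX := hL.isDer_del k
  have h := hX.congr (fun q hq => hL.Fh_mul_self hq) hp
  rw [hX.mul hL.sm_Fh hL.sm_Fh p hp, hL.del_self k hp] at h
  refine (mul_eq_zero.mp (?_ : Fh L p * del L (Fh L) k p = 0)).resolve_left (hL.Fh_ne hp)
  linear_combination (1 / 2) * h

lemma IsCFM.del_sg (hL : IsCFM 2 D L) (k : Fin 2) {p : Pt 2} (hp : p ∈ D) :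
    del L (sg L) k p = (1 / 2) * sg L p * ∑ j, Lc L j j k p := by
  have hX := hL.isDer_del k
  have hg := hL.sm_gm
  have h := hX.congr (fun q hq => (hL.sg_mul_self hq).trans (gmat_det L q)) hp
  have hd := hL.sg_mul_self hp
  rw [gmat_det] at hd
  rw [hX.mul hL.sm_sg hL.sm_sg p hp,
    hX.sub ((hg 0 0).mul (hg 1 1)) ((hg 0 1).mul (hg 1 0)) hp,
    hX.mul (hg 0 0) (hg 1 1) p hp, hX.mul (hg 0 1) (hg 1 0) p hp] at h
  simp only [← hL.sum_gm_mul_Lc _ _ _ hp, Fin.sum_univ_two] at h ⊢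
  refine mul_left_cancel₀ (hL.sg_ne hp) ?_
  linear_combination (1 / 2) * h - (1 / 2) * (Lc L 0 0 k p + Lc L 1 1 k p) * hd

lemma IsCFM.sJ_eq (hL : IsCFM 2 D L) {p : Pt 2} (hp : p ∈ D) :
    Fh L p ^ 3 * sJ L p = ∑ k, p.2 k * dz L k p := by
  have hF := hL.Fh_ne hp
  simp only [sJ, lup, hL.llow_eq _ hp, hL.dz_self _ hp, ← hL.sum_Lc_mul _ _ hp,
    Fin.sum_univ_two]
  field_simp
  ring

lemma IsCFM.sO_eq (hL : IsCFM 2 D L) {p : Pt 2} (hp : p ∈ D) :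
    Fh L p ^ 3 * sO L p = sg L p * (p.2 0 * ∑ h, Nc L 1 h p * p.2 h
      - p.2 1 * ∑ h, Nc L 0 h p * p.2 h) := by
  have hF := hL.Fh_ne hp
  simp only [sO, lup, (hL.mlow_eq hp).1, (hL.mlow_eq hp).2, ← hL.sum_Lc_mul _ _ hp,
    Fin.sum_univ_two]
  field_simp
  ring

lemma IsCFM.sum_trace_Lc (hL : IsCFM 2 D L) {p : Pt 2} (hp : p ∈ D) :
    ∑ s, p.2 s * ∑ j, Lc L j j s p = Fh L p * (sJ L p + sY L p) := by
  have hF := hL.Fh_ne hp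
  have hs := hL.sg_ne hp
  have hE := (hL.euler hp).1
  rw [← hL.Fh_mul_self hp] at hE
  simp only [sJ, sY, lup, mup, (hL.mlow_eq hp).1, (hL.mlow_eq hp).2, hL.llow_eq _ hp,
    Fin.sum_univ_two, one_ne_zero, if_true, if_false] at hE ⊢
  field_simp
  linear_combination (-(p.2 0 * (Lc L 0 0 0 p + Lc L 1 1 0 p)
    + p.2 1 * (Lc L 0 0 1 p + Lc L 1 1 1 p))) * hE

lemma IsCFM.sm_Fh_pow (hL : IsCFM 2 D L) : Sm D (fun q => Fh L q ^ 3) := by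
  simpa only [pow_three] using hL.sm_Fh.mul (hL.sm_Fh.mul hL.sm_Fh)

lemma IsCFM.del_Fh_pow_mul (hL : IsCFM 2 D L) {f : Pt 2 → ℂ} (hf : Sm D f) (k : Fin 2)
    {p : Pt 2} (hp : p ∈ D) :
    del L (fun q => Fh L q ^ 3 * f q) k p = Fh L p ^ 3 * del L f k p := by
  have hX := hL.isDer_del k
  have h : del L (fun q => Fh L q ^ 3) k p = 0 := by
    simp only [pow_three]
    rw [hX.mul hL.sm_Fh (hL.sm_Fh.mul hL.sm_Fh) p hp, hX.mul hL.sm_Fh hL.sm_Fh p hp,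
      hL.del_Fh k hp]
    ring
  rw [hX.mul hL.sm_Fh_pow hf p hp, h]
  ring

lemma IsCFM.sm_of_Fh_pow_mul (hL : IsCFM 2 D L) {f g : Pt 2 → ℂ} (hg : Sm D g)
    (h : ∀ p ∈ D, Fh L p ^ 3 * f p = g p) : Sm D f :=
  (hg.div hL.sm_Fh_pow fun p hp => pow_ne_zero 3 (hL.Fh_ne hp)).congr fun p hp => by
    simp only [← h p hp, mul_div_cancel_left₀ _ (pow_ne_zero 3 (hL.Fh_ne hp))]

lemma IsCFM.sm_sJ (hL : IsCFM 2 D L) : Sm D (sJ L) :=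
  hL.sm_of_Fh_pow_mul (Sm.sum fun k => (Sm.snd k).mul (hL.sm.dz hL.openD k))
    fun _ hp => hL.sJ_eq hp

lemma IsCFM.sm_sO (hL : IsCFM 2 D L) : Sm D (sO L) :=
  hL.sm_of_Fh_pow_mul (hL.sm_sg.mul
    (((Sm.snd 0).mul (Sm.sum fun h => (hL.sm_Nc 1 h).mul (Sm.snd h))).sub
    ((Sm.snd 1).mul (Sm.sum fun h => (hL.sm_Nc 0 h).mul (Sm.snd h))))) fun _ hp => hL.sO_eq hp

lemma IsCFM.del_conj_sJ (hL : IsCFM 2 D L) (s : Fin 2) {p : Pt 2} (hp : p ∈ D) :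
    Fh L p ^ 3 * del L (fun q => (starRingEnd ℂ) (sJ L q)) s p =
      ∑ h, (starRingEnd ℂ) (p.2 h) * del L (dzbar L h) s p := by
  have hX := hL.isDer_del s
  rw [← hL.del_Fh_pow_mul hL.sm_sJ.conj s hp]
  have he : Set.EqOn (fun q => Fh L q ^ 3 * (starRingEnd ℂ) (sJ L q))
      (fun q => ∑ h, (starRingEnd ℂ) (q.2 h) * dzbar L h q) D := fun q hq => by
    have := congrArg (starRingEnd ℂ) (hL.sJ_eq hq)
    simpa only [map_mul, map_pow, conj_Fh, map_sum, ← (hL.dzbar_eq_conj _ hq :)] using this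
  rw [hX.congr he hp,
    hX.sum_mul (fun h => (Sm.snd h).conj) (fun h => hL.sm.dzbar hL.openD h) hp]
  simp [del_conj_snd]

lemma IsCFM.del_conj_sO (hL : IsCFM 2 D L) (s : Fin 2) {p : Pt 2} (hp : p ∈ D) :
    Fh L p ^ 3 * del L (fun q => (starRingEnd ℂ) (sO L q)) s p =
      (1 / 2) * (∑ j, Lc L j j s p) * (Fh L p ^ 3 * (starRingEnd ℂ) (sO L p))
      + sg L p * ((starRingEnd ℂ) (p.2 0) * (∑ h, (starRingEnd ℂ) (p.2 h) *
          del L (fun q => (starRingEnd ℂ) (Nc L 1 h q)) s p)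
        - (starRingEnd ℂ) (p.2 1) * ∑ h, (starRingEnd ℂ) (p.2 h) *
          del L (fun q => (starRingEnd ℂ) (Nc L 0 h q)) s p) := by
  have hX := hL.isDer_del s
  have hN := fun l h => (hL.sm_Nc l h).conj
  have hη : ∀ i, Sm D fun q => (starRingEnd ℂ) (q.2 i) := fun i => (Sm.snd i).conj
  have hQ : ∀ l, Sm D fun q => ∑ h, (starRingEnd ℂ) (Nc L l h q) * (starRingEnd ℂ) (q.2 h) :=
    fun l => Sm.sum fun h => (hN l h).mul (hη h)
  have he : Set.EqOn (fun q => Fh L q ^ 3 * (starRingEnd ℂ) (sO L q))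
      (fun q => sg L q * ((starRingEnd ℂ) (q.2 0) *
          (∑ h, (starRingEnd ℂ) (Nc L 1 h q) * (starRingEnd ℂ) (q.2 h))
        - (starRingEnd ℂ) (q.2 1) *
          ∑ h, (starRingEnd ℂ) (Nc L 0 h q) * (starRingEnd ℂ) (q.2 h))) D := fun q hq => by
    have := congrArg (starRingEnd ℂ) (hL.sO_eq hq)
    simpa only [map_mul, map_sub, map_pow, conj_Fh, conj_sg, map_sum] using this
  have he' := he hp
  beta_reduce at he'
  rw [← hL.del_Fh_pow_mul hL.sm_sO.conj s hp, hX.congr he hp, he',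
    hX.mul hL.sm_sg (((hη 0).mul (hQ 1)).sub ((hη 1).mul (hQ 0))) p hp,
    hX.sub ((hη 0).mul (hQ 1)) ((hη 1).mul (hQ 0)) hp,
    hX.mul (hη 0) (hQ 1) p hp, hX.mul (hη 1) (hQ 0) p hp,
    hX.sum_mul (hN 0) hη hp, hX.sum_mul (hN 1) hη hp, hL.del_sg s hp]
  simp only [del_conj_snd, Fin.sum_univ_two]
  ring

lemma IsCFM.eq_zero_of_contract (hL : IsCFM 2 D L) {p : Pt 2} (hp : p ∈ D) {a : Fin 2 → ℂ}
    (hη : ∑ k, p.2 k * a k = 0) (hm : ∑ k, mup L k p * a k = 0) (k : Fin 2) : a k = 0 := by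
  have hF := hL.Fh_ne hp
  have hs := hL.sg_ne hp
  have hE := (hL.euler hp).1
  rw [← hL.Fh_mul_self hp] at hE
  simp only [mup, hL.llow_eq _ hp, Fin.sum_univ_two, one_ne_zero, if_true, if_false] at hη hm hE
  field_simp at hm
  refine (mul_eq_zero.mp (?_ : Fh L p * Fh L p * a k = 0)).resolve_left (mul_ne_zero hF hF)
  fin_cases k
  · simp only [Fin.zero_eta]
    linear_combination -a 0 * hE + de L 0 p * hη - p.2 1 * hm
  · simp only [Fin.mk_one]
    linear_combination -a 1 * hE + de L 1 p * hη + p.2 0 * hm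

end Frame

end Finsler

/-- The difference of the two sides of the weak symmetry condition. -/
def weakSymDefect (L : Pt 2 → ℂ) (k : Fin 2) (p : Pt 2) : ℂ :=
  (∑ r, ∑ h, ∑ s, Rh L r k h s p * (starRingEnd ℂ) (p.2 r) *
      (starRingEnd ℂ) (p.2 h) * p.2 s) -
    ∑ r, ∑ s, ∑ h, Rh L r s h k p * (starRingEnd ℂ) (p.2 r) * p.2 s *
      (starRingEnd ℂ) (p.2 h)

lemma sum_mul_weakSymDefect (L : Pt 2 → ℂ) (p : Pt 2) :
    ∑ k, p.2 k * weakSymDefect L k p = 0 := by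
  simp only [weakSymDefect, Fin.sum_univ_two]
  ring

lemma IsCFM.weakSymDefect_eq {D : Set (Pt 2)} {L : Pt 2 → ℂ} (hL : IsCFM 2 D L) (k : Fin 2)
    {p : Pt 2} (hp : p ∈ D) :
    weakSymDefect L k p =
      Fh L p ^ 3 * del L (fun q => (starRingEnd ℂ) (sJ L q)) k p -
      ∑ s, p.2 s * ∑ l, gm L k l p * ∑ h, (starRingEnd ℂ) (p.2 h) *
        del L (fun q => (starRingEnd ℂ) (Nc L l h q)) s p := by
  have hR := fun j h k => hL.sum_Rh_mul_conj j h k hp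
  rw [hL.del_conj_sJ k hp]
  simp only [← hL.sum_debar_mul_del_conj_Nc _ _ hp, ← hL.sum_gm_mul _ hp, weakSymDefect,
    Fin.sum_univ_two] at hR ⊢
  linear_combination (starRingEnd ℂ) (p.2 0) * p.2 0 * (hR k 0 0 - hR 0 0 k)
    + (starRingEnd ℂ) (p.2 1) * p.2 0 * (hR k 1 0 - hR 0 1 k)
    + (starRingEnd ℂ) (p.2 0) * p.2 1 * (hR k 0 1 - hR 1 0 k)
    + (starRingEnd ℂ) (p.2 1) * p.2 1 * (hR k 1 1 - hR 1 1 k)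

lemma IsCFM.sum_mup_mul_weakSymDefect {D : Set (Pt 2)} {L : Pt 2 → ℂ} (hL : IsCFM 2 D L)
    {p : Pt 2} (hp : p ∈ D) :
    ∑ k, mup L k p * weakSymDefect L k p =
      Fh L p ^ 3 * ((∑ s, del L (fun q => (starRingEnd ℂ) (sJ L q)) s p * mup L s p) -
        ((1 / Fh L p) * (∑ k, del L (fun q => (starRingEnd ℂ) (sO L q)) k p * p.2 k) -
          (1 / 2) * (starRingEnd ℂ) (sO L p) * (sJ L p + sY L p))) := by
  have hF := hL.Fh_ne hp
  have hO := fun s => hL.del_conj_sO s hp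
  have ht := hL.sum_trace_Lc hp
  have hm0 := hL.sum_mup_mul_gm 0 hp
  have hm1 := hL.sum_mup_mul_gm 1 hp
  simp only [(hL.mlow_eq hp).1, (hL.mlow_eq hp).2, map_div₀, map_neg, map_mul, conj_Fh,
    conj_sg] at hm0 hm1
  simp only [hL.weakSymDefect_eq _ hp, Fin.sum_univ_two] at hO ht hm0 hm1 ⊢
  linear_combination (norm := (field_simp; ring))
    -(p.2 0 * ((starRingEnd ℂ) (p.2 0) * del L (fun q => (starRingEnd ℂ) (Nc L 0 0 q)) 0 p
        + (starRingEnd ℂ) (p.2 1) * del L (fun q => (starRingEnd ℂ) (Nc L 0 1 q)) 0 p)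
      + p.2 1 * ((starRingEnd ℂ) (p.2 0) * del L (fun q => (starRingEnd ℂ) (Nc L 0 0 q)) 1 p
        + (starRingEnd ℂ) (p.2 1) * del L (fun q => (starRingEnd ℂ) (Nc L 0 1 q)) 1 p)) * hm0
    - (p.2 0 * ((starRingEnd ℂ) (p.2 0) * del L (fun q => (starRingEnd ℂ) (Nc L 1 0 q)) 0 p
        + (starRingEnd ℂ) (p.2 1) * del L (fun q => (starRingEnd ℂ) (Nc L 1 1 q)) 0 p)
      + p.2 1 * ((starRingEnd ℂ) (p.2 0) * del L (fun q => (starRingEnd ℂ) (Nc L 1 0 q)) 1 p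
        + (starRingEnd ℂ) (p.2 1) * del L (fun q => (starRingEnd ℂ) (Nc L 1 1 q)) 1 p)) * hm1
    + (1 / Fh L p) * (p.2 0 * hO 0 + p.2 1 * hO 1)
    + (1 / 2) * Fh L p ^ 2 * (starRingEnd ℂ) (sO L p) * ht

/-- the weak symmetry condition holds iff
`δ_s(J̄) m^s = (1/F) δ_k(Ō) η^k − ½ Ō (J+Y)`. -/
theorem statement13 (D : Set (Pt 2)) (L : Pt 2 → ℂ) (hL : IsCFM 2 D L) :
    WeakSym L D ↔
      ∀ p ∈ D,
        (∑ s, del L (fun q => (starRingEnd ℂ) (sJ L q)) s p * mup L s p) =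
          (1 / Fh L p) * (∑ k, del L (fun q => (starRingEnd ℂ) (sO L q)) k p * p.2 k) -
            (1 / 2) * (starRingEnd ℂ) (sO L p) * (sJ L p + sY L p) := by
  refine forall₂_congr fun p hp => ?_
  have h1 : (∀ k, weakSymDefect L k p = 0) ↔ ∑ k, mup L k p * weakSymDefect L k p = 0 :=
    ⟨fun h => by simp [h], fun h => hL.eq_zero_of_contract hp (sum_mul_weakSymDefect L p) h⟩
  rw [hL.sum_mup_mul_weakSymDefect hp, mul_eq_zero,
    or_iff_right (pow_ne_zero 3 (hL.Fh_ne hp)), sub_eq_zero] at h1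
  rw [← h1]
  exact forall_congr' fun k => sub_eq_zero.symm

end CFinsler
end
end

section
/- If a two-dimensional complex Finsler metric on D is weakly Kähler and satisfies the weak symmetry condition R_{r̄kh̄s}η̄^rη̄^hη^s = R_{r̄sh̄k}η̄^rη^sη̄^h (for k ∈ {1,2}) at every point of D, then at every point of D either A = 0 or δ_s̄(J)·m̄^s = 0. -/
open Complex

noncomputable section

namespace CFinsler

variable {n : ℕ}

variable (L : Pt n → ℂ)

section Calculus

open scoped ContDiff

/-- The first order operator `½ (∂_u + c ∂_v)`, of which the Wirtinger derivatives are
instances. -/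
def wd {E : Type*} [NormedAddCommGroup E] [NormedSpace ℝ E] (c : ℂ) (u v : E) (f : E → ℂ)
    (p : E) : ℂ :=
  (1 / 2) * (fderiv ℝ f p u + c * fderiv ℝ f p v)

/-- `T` acts on the smooth functions on `D` as a derivation. -/
structure IsDer_s14 {E : Type*} [NormedAddCommGroup E] [NormedSpace ℝ E] (D : Set E)
    (T : (E → ℂ) → E → ℂ) : Prop where
  congr : ∀ f g : E → ℂ, (∀ q ∈ D, f q = g q) → ∀ p ∈ D, T f p = T g p
  smooth : ∀ f : E → ℂ, ContDiffOn ℝ ∞ f D → ContDiffOn ℝ ∞ (T f) D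
  add : ∀ f g : E → ℂ, ContDiffOn ℝ ∞ f D → ContDiffOn ℝ ∞ g D →
    ∀ p ∈ D, T (fun q => f q + g q) p = T f p + T g p
  mul : ∀ f g : E → ℂ, ContDiffOn ℝ ∞ f D → ContDiffOn ℝ ∞ g D →
    ∀ p ∈ D, T (fun q => f q * g q) p = T f p * g p + f p * T g p

variable {E : Type*} [NormedAddCommGroup E] [NormedSpace ℝ E] {D : Set E}

lemma smooth_differentiableAt (hD : IsOpen D) {f : E → ℂ} (hf : ContDiffOn ℝ ∞ f D) {p : E}
    (hp : p ∈ D) : DifferentiableAt ℝ f p :=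
  (hf.differentiableOn (by simp)).differentiableAt (hD.mem_nhds hp)

lemma smooth_fderiv (hD : IsOpen D) {f : E → ℂ} (hf : ContDiffOn ℝ ∞ f D) :
    ContDiffOn ℝ ∞ (fderiv ℝ f) D :=
  hf.fderiv_of_isOpen hD (by simp)

lemma isDer_wd (hD : IsOpen D) (c : ℂ) (u v : E) : IsDer_s14 D (wd c u v) where
  congr f g h p hp := by
    have : f =ᶠ[nhds p] g := Filter.eventuallyEq_of_mem (hD.mem_nhds hp) h
    simp only [wd, this.fderiv_eq]
  smooth f hf := by
    have h := smooth_fderiv hD hf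
    exact contDiffOn_const.mul ((h.clm_apply contDiffOn_const).add
      (contDiffOn_const.mul (h.clm_apply contDiffOn_const)))
  add f g hf hg p hp := by
    simp only [wd]
    rw [fderiv_fun_add (smooth_differentiableAt hD hf hp) (smooth_differentiableAt hD hg hp)]
    simp only [_root_.add_apply]
    ring
  mul f g hf hg p hp := by
    simp only [wd]
    rw [fderiv_fun_mul (smooth_differentiableAt hD hf hp) (smooth_differentiableAt hD hg hp)]
    simp only [_root_.add_apply, _root_.smul_apply, smul_eq_mul]
    ring

lemma fderiv_wd (hD : IsOpen D) {f : E → ℂ} (hf : ContDiffOn ℝ ∞ f D) {p : E} (hp : p ∈ D)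
    (c : ℂ) (u v w : E) :
    fderiv ℝ (wd c u v f) p w =
      (1 / 2) * (fderiv ℝ (fderiv ℝ f) p w u + c * fderiv ℝ (fderiv ℝ f) p w v) := by
  have h : DifferentiableAt ℝ (fderiv ℝ f) p :=
    ((smooth_fderiv hD hf).differentiableOn (by simp)).differentiableAt (hD.mem_nhds hp)
  have hu (x : E) : HasFDerivAt (fun q => fderiv ℝ f q x) ((fderiv ℝ (fderiv ℝ f) p).flip x) p := by
    simpa using h.hasFDerivAt.clm_apply (hasFDerivAt_const x p)
  have := (((hu u).add ((hu v).const_mul c)).const_mul (1 / 2 : ℂ)).fderiv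
  unfold wd
  refine (congrArg (fun l => l w) this).trans ?_
  simp [mul_add]

lemma wd_comm (hD : IsOpen D) {f : E → ℂ} (hf : ContDiffOn ℝ ∞ f D) {p : E} (hp : p ∈ D)
    (c c' : ℂ) (u v u' v' : E) :
    wd c u v (wd c' u' v' f) p = wd c' u' v' (wd c u v f) p := by
  have hs : IsSymmSndFDerivAt ℝ f p :=
    (hf.contDiffAt (hD.mem_nhds hp)).isSymmSndFDerivAt
      (by simpa using WithTop.coe_le_coe.2 (le_top (a := (2 : ℕ∞))))
  unfold IsSymmSndFDerivAt at hs
  rw [wd, wd]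
  simp only [fderiv_wd hD hf hp]
  rw [hs u u', hs u v', hs v u', hs v v']
  ring

lemma conj_wd (c : ℂ) (u v : E) (f : E → ℂ) (p : E) :
    (starRingEnd ℂ) (wd c u v f p) =
      wd ((starRingEnd ℂ) c) u v (fun q => (starRingEnd ℂ) (f q)) p := by
  have h : fderiv ℝ (fun q => (starRingEnd ℂ) (f q)) p =
      (Complex.conjCLE : ℂ →L[ℝ] ℂ).comp (fderiv ℝ f p) :=
    Complex.conjCLE.comp_fderiv (f := f) (x := p)
  rw [wd, wd, h]
  simp [Complex.conj_ofNat]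

namespace IsDer_s14

variable {T : (E → ℂ) → E → ℂ}

lemma apply_add (hT : IsDer_s14 D T) {k f g : E → ℂ} (hf : ContDiffOn ℝ ∞ f D)
    (hg : ContDiffOn ℝ ∞ g D) (h : ∀ q ∈ D, k q = f q + g q) {p : E} (hp : p ∈ D) :
    T k p = T f p + T g p := by
  rw [hT.congr _ _ h p hp, hT.add f g hf hg p hp]

/-- The Leibniz rule for a pairing of two pairs of functions. -/
lemma apply_pairing (hT : IsDer_s14 D T) {k f₀ f₁ g₀ g₁ : E → ℂ}
    (hf₀ : ContDiffOn ℝ ∞ f₀ D) (hf₁ : ContDiffOn ℝ ∞ f₁ D)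
    (hg₀ : ContDiffOn ℝ ∞ g₀ D) (hg₁ : ContDiffOn ℝ ∞ g₁ D)
    (h : ∀ q ∈ D, k q = f₀ q * g₀ q + f₁ q * g₁ q) {p : E} (hp : p ∈ D) :
    T k p = (T f₀ p * g₀ p + f₀ p * T g₀ p) + (T f₁ p * g₁ p + f₁ p * T g₁ p) := by
  rw [hT.apply_add (hf₀.mul hg₀) (hf₁.mul hg₁) h hp, ← hT.mul f₀ g₀ hf₀ hg₀ p hp,
    ← hT.mul f₁ g₁ hf₁ hg₁ p hp]

lemma apply_zero (hT : IsDer_s14 D T) {k : E → ℂ} (h : ∀ q ∈ D, k q = 0) {p : E} (hp : p ∈ D) :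
    T k p = 0 := by
  have h0 := hT.apply_add (k := fun _ => 0) (f := fun _ => 0) (g := fun _ => 0)
    contDiffOn_const contDiffOn_const (by simp) hp
  rw [hT.congr k (fun _ => 0) h p hp]
  simpa using h0

end IsDer_s14

end Calculus

section Wirtinger

variable {n : ℕ}

lemma dz_eq_wd (k : Fin n) :
    (fun f : Pt n → ℂ => dz f k) = wd (-Complex.I) (Pi.single k 1, 0) (Pi.single k Complex.I, 0) := by
  funext f p
  simp only [dz, wd, neg_mul, sub_eq_add_neg]

lemma dzbar_eq_wd (k : Fin n) :
    (fun f : Pt n → ℂ => dzbar f k) = wd Complex.I (Pi.single k 1, 0) (Pi.single k Complex.I, 0) :=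
  rfl

lemma de_eq_wd (k : Fin n) :
    (fun f : Pt n → ℂ => de f k) = wd (-Complex.I) (0, Pi.single k 1) (0, Pi.single k Complex.I) := by
  funext f p
  simp only [de, wd, neg_mul, sub_eq_add_neg]

lemma debar_eq_wd (k : Fin n) :
    (fun f : Pt n → ℂ => debar f k) = wd Complex.I (0, Pi.single k 1) (0, Pi.single k Complex.I) :=
  rfl

/-- `T` is one of the constant coefficient operators `wd`. -/
def IsWd (T : (Pt n → ℂ) → Pt n → ℂ) : Prop := ∃ c u v, T = wd c u v

lemma isWd_dz (k : Fin n) : IsWd (fun f => dz f k) := ⟨_, _, _, dz_eq_wd k⟩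
lemma isWd_dzbar (k : Fin n) : IsWd (fun f => dzbar f k) := ⟨_, _, _, dzbar_eq_wd k⟩
lemma isWd_de (k : Fin n) : IsWd (fun f => de f k) := ⟨_, _, _, de_eq_wd k⟩
lemma isWd_debar (k : Fin n) : IsWd (fun f => debar f k) := ⟨_, _, _, debar_eq_wd k⟩

lemma IsWd.isDer {D : Set (Pt n)} (hD : IsOpen D) {T : (Pt n → ℂ) → Pt n → ℂ} (hT : IsWd T) :
    IsDer_s14 D T := by
  obtain ⟨c, u, v, rfl⟩ := hT
  exact isDer_wd hD c u v

open scoped ContDiff in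
lemma IsWd.comm {D : Set (Pt n)} (hD : IsOpen D) {T T' : (Pt n → ℂ) → Pt n → ℂ} (hT : IsWd T)
    (hT' : IsWd T') {f : Pt n → ℂ} (hf : ContDiffOn ℝ ∞ f D) {p : Pt n} (hp : p ∈ D) :
    T (T' f) p = T' (T f) p := by
  obtain ⟨c, u, v, rfl⟩ := hT
  obtain ⟨c', u', v', rfl⟩ := hT'
  exact wd_comm hD hf hp ..

lemma conj_dz (f : Pt n → ℂ) (k : Fin n) (p : Pt n) :
    (starRingEnd ℂ) (dz f k p) = dzbar (fun q => (starRingEnd ℂ) (f q)) k p := by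
  have h := conj_wd (-Complex.I) (Pi.single k 1, 0) (Pi.single k Complex.I, 0) f p
  rw [← dz_eq_wd, map_neg, Complex.conj_I, neg_neg] at h
  exact h

lemma conj_dzbar (f : Pt n → ℂ) (k : Fin n) (p : Pt n) :
    (starRingEnd ℂ) (dzbar f k p) = dz (fun q => (starRingEnd ℂ) (f q)) k p := by
  have h := conj_dz (fun q => (starRingEnd ℂ) (f q)) k p
  simp only [Complex.conj_conj] at h
  rw [← h, Complex.conj_conj]

lemma conj_de (f : Pt n → ℂ) (k : Fin n) (p : Pt n) :
    (starRingEnd ℂ) (de f k p) = debar (fun q => (starRingEnd ℂ) (f q)) k p := by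
  have h := conj_wd (-Complex.I) (0, Pi.single k 1) (0, Pi.single k Complex.I) f p
  rw [← de_eq_wd, map_neg, Complex.conj_I, neg_neg] at h
  exact h

lemma conj_debar (f : Pt n → ℂ) (k : Fin n) (p : Pt n) :
    (starRingEnd ℂ) (debar f k p) = de (fun q => (starRingEnd ℂ) (f q)) k p := by
  have h := conj_de (fun q => (starRingEnd ℂ) (f q)) k p
  simp only [Complex.conj_conj] at h
  rw [← h, Complex.conj_conj]

/-- The fibre coordinate `η^i`. -/
def eta (i : Fin n) (p : Pt n) : ℂ := p.2 i

/-- The conjugate fibre coordinate `η̄^i`. -/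
def etab (i : Fin n) (p : Pt n) : ℂ := (starRingEnd ℂ) (p.2 i)

lemma fderiv_eta (i : Fin n) (p w : Pt n) : fderiv ℝ (eta i) p w = w.2 i := by
  have h : HasFDerivAt (eta i)
      ((ContinuousLinearMap.proj (R := ℝ) i).comp
        (ContinuousLinearMap.snd ℝ (Fin n → ℂ) (Fin n → ℂ))) p :=
    ((ContinuousLinearMap.proj (R := ℝ) i).comp
      (ContinuousLinearMap.snd ℝ (Fin n → ℂ) (Fin n → ℂ))).hasFDerivAt
  rw [h.fderiv]
  rfl

lemma contDiff_eta (i : Fin n) {D : Set (Pt n)} {m} : ContDiffOn ℝ m (eta i) D :=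
  (((ContinuousLinearMap.proj (R := ℝ) i).comp
    (ContinuousLinearMap.snd ℝ (Fin n → ℂ) (Fin n → ℂ))).contDiff).contDiffOn

lemma contDiffOn_conj {D : Set (Pt n)} {m} {f : Pt n → ℂ} (hf : ContDiffOn ℝ m f D) :
    ContDiffOn ℝ m (fun q => (starRingEnd ℂ) (f q)) D :=
  Complex.conjCLE.contDiff.comp_contDiffOn hf

lemma contDiff_etab (i : Fin n) {D : Set (Pt n)} {m} : ContDiffOn ℝ m (etab i) D :=
  contDiffOn_conj (contDiff_eta i)

lemma dz_eta (i k : Fin n) (p : Pt n) : dz (eta i) k p = 0 := by simp [dz, fderiv_eta]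
lemma dzbar_eta (i k : Fin n) (p : Pt n) : dzbar (eta i) k p = 0 := by simp [dzbar, fderiv_eta]
lemma de_eta (i k : Fin n) (p : Pt n) : de (eta i) k p = if i = k then 1 else 0 := by
  by_cases h : i = k
  · subst h; simp [de, fderiv_eta]; norm_num
  · simp [de, fderiv_eta, h]
lemma debar_eta (i k : Fin n) (p : Pt n) : debar (eta i) k p = 0 := by
  by_cases h : i = k
  · subst h; simp [debar, fderiv_eta]
  · simp [debar, fderiv_eta, h]

lemma dz_etab (i k : Fin n) (p : Pt n) : dz (etab i) k p = 0 := by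
  rw [show dz (etab i) k p = _ from (conj_dzbar (eta i) k p).symm, dzbar_eta]
  simp
lemma de_etab (i k : Fin n) (p : Pt n) : de (etab i) k p = 0 := by
  rw [show de (etab i) k p = _ from (conj_debar (eta i) k p).symm, debar_eta]
  simp
lemma debar_etab (i k : Fin n) (p : Pt n) : debar (etab i) k p = if i = k then 1 else 0 := by
  rw [show debar (etab i) k p = _ from (conj_de (eta i) k p).symm, de_eta]
  simp [apply_ite]

end Wirtinger

section Metric

open scoped ContDiff

variable {D : Set (Pt 2)} {L : Pt 2 → ℂ}

lemma fderiv_fibre (f : Pt 2 → ℂ) (p : Pt 2) (a : Fin 2 → ℂ) :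
    fderiv ℝ f p (0, a) =
      a 0 * de f 0 p + a 1 * de f 1 p +
        ((starRingEnd ℂ) (a 0) * debar f 0 p + (starRingEnd ℂ) (a 1) * debar f 1 p) := by
  have ha : ((0, a) : Pt 2) =
      ((a 0).re • ((0 : Fin 2 → ℂ), Pi.single 0 1) +
        (a 0).im • ((0 : Fin 2 → ℂ), Pi.single 0 Complex.I)) +
      ((a 1).re • ((0 : Fin 2 → ℂ), Pi.single 1 1) +
        (a 1).im • ((0 : Fin 2 → ℂ), Pi.single 1 Complex.I)) := by
    refine Prod.ext (by simp) (funext fun i => ?_)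
    fin_cases i <;> simp [Complex.re_add_im]
  rw [ha]
  simp only [map_add, map_smul, Complex.real_smul, de, debar]
  generalize fderiv ℝ f p (0, Pi.single 0 1) = x₀
  generalize fderiv ℝ f p (0, Pi.single 1 1) = x₁
  generalize fderiv ℝ f p (0, Pi.single 0 Complex.I) = y₀
  generalize fderiv ℝ f p (0, Pi.single 1 Complex.I) = y₁
  have h₀ := Complex.re_add_im (a 0)
  have h₁ := Complex.re_add_im (a 1)
  have hc (w : ℂ) : (starRingEnd ℂ) w = w.re - w.im * Complex.I := by
    apply Complex.ext <;> simp
  rw [hc, hc]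
  generalize (a 0).re = r₀ at *
  generalize (a 1).re = r₁ at *
  generalize (a 0).im = s₀ at *
  generalize (a 1).im = s₁ at *
  rw [← h₀, ← h₁]
  linear_combination (s₀ * y₀ + s₁ * y₁) * Complex.I_sq

namespace IsCFM

lemma fderiv_radial_s14 (hL : IsCFM 2 D L) {p : Pt 2} (hp : p ∈ D) (w : ℂ) :
    fderiv ℝ L p (0, w • p.2) = 2 * w.re * L p := by
  have hγ : HasDerivAt (fun t : ℝ => ((p.1, (1 + (t : ℂ) * w) • p.2) : Pt 2)) (0, w • p.2) 0 := by
    refine (hasDerivAt_const _ _).prodMk ?_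
    have h : HasDerivAt (fun t : ℝ => 1 + (t : ℂ) * w) w 0 := by
      simpa using ((Complex.ofRealCLM.hasDerivAt (x := (0 : ℝ))).mul_const w).const_add 1
    exact h.smul_const p.2
  have hd : HasFDerivAt L (fderiv ℝ L p) ((p.1, (1 + ((0 : ℝ) : ℂ) * w) • p.2) : Pt 2) := by
    simpa using (smooth_differentiableAt hL.openD hL.smooth hp).hasFDerivAt
  have h₁ := hd.comp_hasDerivAt (0 : ℝ) hγ
  have hn : HasDerivAt (fun t : ℝ => ((Complex.normSq (1 + (t : ℂ) * w) : ℝ) : ℂ) * L p)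
      (2 * w.re * L p) 0 := by
    have h : HasDerivAt (fun t : ℝ => (1 + t * w.re) * (1 + t * w.re) + (t * w.im) * (t * w.im))
        (2 * w.re) 0 := by
      have h1 : HasDerivAt (fun t : ℝ => 1 + t * w.re) w.re 0 := by
        simpa using ((hasDerivAt_id (0 : ℝ)).mul_const w.re).const_add 1
      have h2 : HasDerivAt (fun t : ℝ => t * w.im) w.im 0 := by
        simpa using (hasDerivAt_id (0 : ℝ)).mul_const w.im
      exact ((h1.mul h1).add (h2.mul h2)).congr_deriv (by simp; ring)
    have h' := (h.ofReal_comp).mul_const (L p)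
    refine (h'.congr_deriv (by push_cast; ring)).congr_of_eventuallyEq (.of_forall fun t => ?_)
    simp [Complex.normSq_apply]
  have hev : (fun t : ℝ => L (p.1, (1 + (t : ℂ) * w) • p.2)) =ᶠ[nhds 0]
      fun t : ℝ => ((Complex.normSq (1 + (t : ℂ) * w) : ℝ) : ℂ) * L p := by
    have hc : ContinuousAt (fun t : ℝ => 1 + (t : ℂ) * w) 0 := by fun_prop
    filter_upwards [hc.eventually_ne (by simp : 1 + ((0 : ℝ) : ℂ) * w ≠ 0)] with t ht
    exact hL.homog p hp _ ht
  exact h₁.unique (hn.congr_of_eventuallyEq hev)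

lemma euler_s14 (hL : IsCFM 2 D L) {p : Pt 2} (hp : p ∈ D) :
    L p = de L 0 p * eta 0 p + de L 1 p * eta 1 p := by
  have h₁ := hL.fderiv_radial_s14 hp 1
  have h₂ := hL.fderiv_radial_s14 hp Complex.I
  rw [fderiv_fibre] at h₁ h₂
  simp only [Pi.smul_apply, smul_eq_mul, one_mul, map_mul, Complex.conj_I, Complex.one_re,
    Complex.I_re, Complex.ofReal_one, Complex.ofReal_zero] at h₁ h₂
  simp only [eta]
  linear_combination (-1 / 2) * h₁ + (Complex.I / 2) * h₂ - (1 / 2) * (p.2 0 * de L 0 p +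
    p.2 1 * de L 1 p - ((starRingEnd ℂ) (p.2 0) * debar L 0 p +
      (starRingEnd ℂ) (p.2 1) * debar L 1 p)) * Complex.I_sq

lemma conj_self (hL : IsCFM 2 D L) {p : Pt 2} (hp : p ∈ D) : (starRingEnd ℂ) (L p) = L p :=
  Complex.conj_eq_iff_im.2 (hL.real_im p hp)

lemma conj_de_self (hL : IsCFM 2 D L) (k : Fin 2) {p : Pt 2} (hp : p ∈ D) :
    (starRingEnd ℂ) (de L k p) = debar L k p := by
  rw [conj_de]
  exact ((isWd_debar k).isDer hL.openD).congr _ _ (fun q hq => hL.conj_self hq) p hp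

lemma euler_bar (hL : IsCFM 2 D L) {p : Pt 2} (hp : p ∈ D) :
    L p = debar L 0 p * etab 0 p + debar L 1 p * etab 1 p := by
  rw [← hL.conj_self hp, hL.euler_s14 hp]
  simp only [map_add, map_mul, hL.conj_de_self _ hp, etab, eta]

section Smoothness

lemma smooth_dz (hL : IsCFM 2 D L) {f : Pt 2 → ℂ} (hf : ContDiffOn ℝ ∞ f D) (k : Fin 2) :
    ContDiffOn ℝ ∞ (dz f k) D := ((isWd_dz k).isDer hL.openD).smooth f hf
lemma smooth_de (hL : IsCFM 2 D L) {f : Pt 2 → ℂ} (hf : ContDiffOn ℝ ∞ f D) (k : Fin 2) :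
    ContDiffOn ℝ ∞ (de f k) D := ((isWd_de k).isDer hL.openD).smooth f hf
lemma smooth_debar (hL : IsCFM 2 D L) {f : Pt 2 → ℂ} (hf : ContDiffOn ℝ ∞ f D) (k : Fin 2) :
    ContDiffOn ℝ ∞ (debar f k) D := ((isWd_debar k).isDer hL.openD).smooth f hf

lemma smooth_gm (hL : IsCFM 2 D L) (i j : Fin 2) : ContDiffOn ℝ ∞ (gm L i j) D :=
  hL.smooth_de (hL.smooth_debar hL.smooth j) i

lemma det_ne_zero (hL : IsCFM 2 D L) {p : Pt 2} (hp : p ∈ D) : (gmat L p).det ≠ 0 := by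
  intro h
  obtain ⟨v, hv, hv0⟩ := Matrix.exists_vecMul_eq_zero_iff.2 h
  have hpos := hL.posdef p hp v hv
  have h₀ := congrFun hv0 0
  have h₁ := congrFun hv0 1
  simp only [Matrix.vecMul, dotProduct, Fin.sum_univ_two, gmat, Pi.zero_apply] at h₀ h₁
  have hz : ∑ i, ∑ j, gm L i j p * v i * (starRingEnd ℂ) (v j) = 0 := by
    simp only [Fin.sum_univ_two]
    linear_combination (starRingEnd ℂ) (v 0) * h₀ + (starRingEnd ℂ) (v 1) * h₁
  rw [hz] at hpos
  simp at hpos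

lemma smooth_gi (hL : IsCFM 2 D L) (l i : Fin 2) : ContDiffOn ℝ ∞ (gi L l i) D := by
  have hadj : ContDiffOn ℝ ∞ (fun p => (gmat L p).adjugate l i) D := by
    have hg := hL.smooth_gm
    fin_cases l <;> fin_cases i <;> simp only [Matrix.adjugate_fin_two, gmat] <;>
      simp <;> first | exact hg _ _ | exact (hg _ _).neg
  have hdet : ContDiffOn ℝ ∞ (fun p => (gmat L p).det) D := by
    simp only [Matrix.det_fin_two, gmat]
    exact ((hL.smooth_gm 0 0).mul (hL.smooth_gm 1 1)).sub
      ((hL.smooth_gm 0 1).mul (hL.smooth_gm 1 0))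
  refine ((hdet.inv fun p hp => hL.det_ne_zero hp).mul hadj).congr fun p _ => ?_
  simp [gi, Matrix.inv_def]

lemma smooth_Nc (hL : IsCFM 2 D L) (i k : Fin 2) : ContDiffOn ℝ ∞ (Nc L i k) D :=
  ContDiffOn.sum fun m _ => ContDiffOn.sum fun l _ =>
    ((hL.smooth_gi m i).mul (hL.smooth_dz (hL.smooth_gm l m) k)).mul (contDiff_eta l)

lemma smooth_conj_Nc (hL : IsCFM 2 D L) (i k : Fin 2) :
    ContDiffOn ℝ ∞ (fun p => (starRingEnd ℂ) (Nc L i k p)) D :=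
  contDiffOn_conj (hL.smooth_Nc i k)

end Smoothness

lemma isDer_sub {T : (Pt 2 → ℂ) → Pt 2 → ℂ} {S : Fin 2 → (Pt 2 → ℂ) → Pt 2 → ℂ}
    {c : Fin 2 → Pt 2 → ℂ} (hT : IsDer_s14 D T) (hS : ∀ j, IsDer_s14 D (S j))
    (hc : ∀ j, ContDiffOn ℝ ∞ (c j) D) :
    IsDer_s14 D (fun f p => T f p - ∑ j, c j p * S j f p) where
  congr f g h p hp := by
    simp only [hT.congr f g h p hp, fun j => (hS j).congr f g h p hp]
  smooth f hf := (hT.smooth f hf).sub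
    (ContDiffOn.sum fun j _ => (hc j).mul ((hS j).smooth f hf))
  add f g hf hg p hp := by
    simp only [hT.add f g hf hg p hp, fun j => (hS j).add f g hf hg p hp, Fin.sum_univ_two]
    ring
  mul f g hf hg p hp := by
    simp only [hT.mul f g hf hg p hp, fun j => (hS j).mul f g hf hg p hp, Fin.sum_univ_two]
    ring

lemma isDer_del_s14 (hL : IsCFM 2 D L) (k : Fin 2) : IsDer_s14 D (fun f => del L f k) :=
  isDer_sub ((isWd_dz k).isDer hL.openD) (fun j => (isWd_de j).isDer hL.openD)
    (fun j => hL.smooth_Nc j k)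

lemma isDer_delbar_s14 (hL : IsCFM 2 D L) (k : Fin 2) : IsDer_s14 D (fun f => delbar L f k) :=
  isDer_sub ((isWd_dzbar k).isDer hL.openD) (fun j => (isWd_debar j).isDer hL.openD)
    (fun j => hL.smooth_conj_Nc j k)

lemma smooth_del (hL : IsCFM 2 D L) {f : Pt 2 → ℂ} (hf : ContDiffOn ℝ ∞ f D) (k : Fin 2) :
    ContDiffOn ℝ ∞ (del L f k) D := (hL.isDer_del_s14 k).smooth f hf

lemma smooth_delbar (hL : IsCFM 2 D L) {f : Pt 2 → ℂ} (hf : ContDiffOn ℝ ∞ f D) (k : Fin 2) :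
    ContDiffOn ℝ ∞ (delbar L f k) D := (hL.isDer_delbar_s14 k).smooth f hf

lemma smooth_Lc (hL : IsCFM 2 D L) (i j k : Fin 2) : ContDiffOn ℝ ∞ (Lc L i j k) D :=
  ContDiffOn.sum fun l _ => (hL.smooth_gi l i).mul (hL.smooth_del (hL.smooth_gm j l) k)

lemma delbar_eta (i k : Fin 2) (p : Pt 2) : delbar L (eta i) k p = 0 := by
  simp [delbar, dzbar_eta, debar_eta]

lemma del_etab (i k : Fin 2) (p : Pt 2) : del L (etab i) k p = 0 := by
  simp [del, dz_etab, de_etab]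

/-- Constant coefficient operators commute with `δ_h̄` up to a vertical term. -/
lemma apply_delbar (hL : IsCFM 2 D L) {T : (Pt 2 → ℂ) → Pt 2 → ℂ} (hT : IsWd T)
    {f : Pt 2 → ℂ} (hf : ContDiffOn ℝ ∞ f D) (h : Fin 2) {p : Pt 2} (hp : p ∈ D) :
    T (delbar L f h) p = delbar L (T f) h p -
      (T (fun q => (starRingEnd ℂ) (Nc L 0 h q)) p * debar f 0 p +
        T (fun q => (starRingEnd ℂ) (Nc L 1 h q)) p * debar f 1 p) := by
  have hTd := hT.isDer hL.openD
  set M : Pt 2 → ℂ := fun q => (starRingEnd ℂ) (Nc L 0 h q) * debar f 0 q +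
    (starRingEnd ℂ) (Nc L 1 h q) * debar f 1 q with hM
  have hdec : ∀ q ∈ D, dzbar f h q = delbar L f h q + M q := fun q _ => by
    simp [delbar, hM]
  have hMs : ContDiffOn ℝ ∞ M D :=
    ((hL.smooth_conj_Nc 0 h).mul (hL.smooth_debar hf 0)).add
      ((hL.smooth_conj_Nc 1 h).mul (hL.smooth_debar hf 1))
  have h₁ := hTd.apply_add (hL.smooth_delbar hf h) hMs hdec hp
  have h₂ := hTd.apply_pairing (k := M) (hL.smooth_conj_Nc 0 h) (hL.smooth_conj_Nc 1 h)
    (hL.smooth_debar hf 0) (hL.smooth_debar hf 1) (fun _ _ => rfl) hp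
  have c₀ : T (dzbar f h) p = dzbar (T f) h p := hT.comm hL.openD (isWd_dzbar h) hf hp
  have c₁ (j : Fin 2) : T (debar f j) p = debar (T f) j p :=
    hT.comm hL.openD (isWd_debar j) hf hp
  simp only [delbar, Fin.sum_univ_two] at h₁ ⊢
  rw [c₁, c₁] at h₂
  linear_combination -h₁ - h₂ + c₀

lemma debar_de_s14 (hL : IsCFM 2 D L) (i j : Fin 2) {p : Pt 2} (hp : p ∈ D) :
    debar (de L i) j p = gm L i j p :=
  (isWd_debar j).comm hL.openD (isWd_de i) hL.smooth hp

lemma de_de_comm (hL : IsCFM 2 D L) (i j : Fin 2) {p : Pt 2} (hp : p ∈ D) :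
    de (de L i) j p = de (de L j) i p :=
  (isWd_de j).comm hL.openD (isWd_de i) hL.smooth hp

lemma smooth_deL (hL : IsCFM 2 D L) (i : Fin 2) : ContDiffOn ℝ ∞ (de L i) D :=
  hL.smooth_de hL.smooth i

lemma smooth_debarL (hL : IsCFM 2 D L) (i : Fin 2) : ContDiffOn ℝ ∞ (debar L i) D :=
  hL.smooth_debar hL.smooth i

lemma gm_eta (hL : IsCFM 2 D L) (m : Fin 2) {p : Pt 2} (hp : p ∈ D) :
    debar L m p = gm L 0 m p * eta 0 p + gm L 1 m p * eta 1 p := by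
  have h : debar L m p = _ := ((isWd_debar m).isDer hL.openD).apply_pairing (hL.smooth_deL 0)
    (hL.smooth_deL 1) (contDiff_eta 0) (contDiff_eta 1) (fun q hq => hL.euler_s14 hq) hp
  simp only [debar_eta, hL.debar_de_s14 _ _ hp] at h
  linear_combination h

lemma gm_etab (hL : IsCFM 2 D L) (k : Fin 2) {p : Pt 2} (hp : p ∈ D) :
    de L k p = gm L k 0 p * etab 0 p + gm L k 1 p * etab 1 p := by
  have h : de L k p = _ := ((isWd_de k).isDer hL.openD).apply_pairing (hL.smooth_debarL 0)
    (hL.smooth_debarL 1) (contDiff_etab 0) (contDiff_etab 1) (fun q hq => hL.euler_bar hq) hp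
  simp only [de_etab] at h
  simp only [gm]
  linear_combination h

lemma de_de_eta (hL : IsCFM 2 D L) (k : Fin 2) {p : Pt 2} (hp : p ∈ D) :
    de (de L 0) k p * eta 0 p + de (de L 1) k p * eta 1 p = 0 := by
  have h : de L k p = _ := ((isWd_de k).isDer hL.openD).apply_pairing (hL.smooth_deL 0)
    (hL.smooth_deL 1) (contDiff_eta 0) (contDiff_eta 1) (fun q hq => hL.euler_s14 hq) hp
  simp only [de_eta] at h
  fin_cases k <;> simp at h ⊢ <;> linear_combination -h

lemma gi_gm (hL : IsCFM 2 D L) (l m : Fin 2) {p : Pt 2} (hp : p ∈ D) :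
    gi L l 0 p * gm L 0 m p + gi L l 1 p * gm L 1 m p = if l = m then 1 else 0 := by
  have h := Matrix.nonsing_inv_mul (gmat L p) (isUnit_iff_ne_zero.2 (hL.det_ne_zero hp))
  have h' := congrFun (congrFun h l) m
  rw [Matrix.mul_apply, Fin.sum_univ_two, Matrix.one_apply] at h'
  exact h'

lemma lower_gi (hL : IsCFM 2 D L) (C : Fin 2 → ℂ) (m : Fin 2) {p : Pt 2} (hp : p ∈ D) :
    (∑ l, gi L l 0 p * C l) * gm L 0 m p + (∑ l, gi L l 1 p * C l) * gm L 1 m p = C m := by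
  have h₀ := hL.gi_gm 0 m hp
  have h₁ := hL.gi_gm 1 m hp
  simp only [Fin.sum_univ_two]
  fin_cases m <;> simp at h₀ h₁ ⊢ <;> linear_combination C 0 * h₀ + C 1 * h₁

lemma dz_debar_s14 (hL : IsCFM 2 D L) (m k : Fin 2) {p : Pt 2} (hp : p ∈ D) :
    dz (debar L m) k p = dz (gm L 0 m) k p * eta 0 p + dz (gm L 1 m) k p * eta 1 p := by
  have h : dz (debar L m) k p = _ := ((isWd_dz k).isDer hL.openD).apply_pairing (hL.smooth_gm 0 m)
    (hL.smooth_gm 1 m) (contDiff_eta 0) (contDiff_eta 1) (fun q hq => hL.gm_eta m hq) hp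
  simp only [dz_eta] at h
  linear_combination h

lemma Nc_gm (hL : IsCFM 2 D L) (k m : Fin 2) {p : Pt 2} (hp : p ∈ D) :
    Nc L 0 k p * gm L 0 m p + Nc L 1 k p * gm L 1 m p = dz (debar L m) k p := by
  rw [hL.dz_debar_s14 m k hp, ← hL.lower_gi
    (fun m => dz (gm L 0 m) k p * eta 0 p + dz (gm L 1 m) k p * eta 1 p) m hp]
  simp only [Nc, eta, Fin.sum_univ_two]
  ring

lemma conj_Nc_gm (hL : IsCFM 2 D L) (k m : Fin 2) {p : Pt 2} (hp : p ∈ D) :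
    (starRingEnd ℂ) (Nc L 0 k p) * gm L m 0 p + (starRingEnd ℂ) (Nc L 1 k p) * gm L m 1 p =
      dzbar (de L m) k p := by
  have h := congrArg (starRingEnd ℂ) (hL.Nc_gm k m hp)
  simp only [map_add, map_mul, hL.hermitian p hp] at h
  rw [h, conj_dz]
  refine ((isWd_dzbar k).isDer hL.openD).congr _ _ (fun q hq => ?_) p hp
  rw [← hL.conj_de_self m hq, Complex.conj_conj]

lemma delbar_deL (hL : IsCFM 2 D L) (m k : Fin 2) {p : Pt 2} (hp : p ∈ D) :
    delbar L (de L m) k p = 0 := by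
  simp only [delbar, Fin.sum_univ_two, hL.debar_de_s14 _ _ hp]
  linear_combination -hL.conj_Nc_gm k m hp

lemma Lc_low (hL : IsCFM 2 D L) (j k : Fin 2) {p : Pt 2} (hp : p ∈ D) :
    Lc L 0 j k p * de L 0 p + Lc L 1 j k p * de L 1 p = del L (de L j) k p := by
  have h : del L (de L j) k p = _ := (hL.isDer_del_s14 k).apply_pairing (hL.smooth_gm j 0)
    (hL.smooth_gm j 1) (contDiff_etab 0) (contDiff_etab 1) (fun q hq => hL.gm_etab j hq) hp
  simp only [del_etab] at h
  have hg (m : Fin 2) := hL.lower_gi (fun l => del L (gm L j l) k p) m hp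
  rw [h, hL.gm_etab 0 hp, hL.gm_etab 1 hp]
  simp only [Lc]
  linear_combination etab 0 p * hg 0 + etab 1 p * hg 1

lemma Cc_low (hL : IsCFM 2 D L) (j k : Fin 2) {p : Pt 2} (hp : p ∈ D) :
    Cc L 0 j k p * de L 0 p + Cc L 1 j k p * de L 1 p = de (de L j) k p := by
  have h : de (de L j) k p = _ := ((isWd_de k).isDer hL.openD).apply_pairing (hL.smooth_gm j 0)
    (hL.smooth_gm j 1) (contDiff_etab 0) (contDiff_etab 1) (fun q hq => hL.gm_etab j hq) hp
  simp only [de_etab] at h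
  have hg (m : Fin 2) := hL.lower_gi (fun l => de (gm L j l) k p) m hp
  rw [h, hL.gm_etab 0 hp, hL.gm_etab 1 hp]
  simp only [Cc]
  linear_combination etab 0 p * hg 0 + etab 1 p * hg 1

/-- `L_i L^i_{jk} η^j = ∂_k L`. -/
lemma Lc_low_eta (hL : IsCFM 2 D L) (k : Fin 2) {p : Pt 2} (hp : p ∈ D) :
    (Lc L 0 0 k p * de L 0 p + Lc L 1 0 k p * de L 1 p) * eta 0 p +
      (Lc L 0 1 k p * de L 0 p + Lc L 1 1 k p * de L 1 p) * eta 1 p = dz L k p := by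
  have h : dz L k p = _ := ((isWd_dz k).isDer hL.openD).apply_pairing (hL.smooth_deL 0)
    (hL.smooth_deL 1) (contDiff_eta 0) (contDiff_eta 1) (fun q hq => hL.euler_s14 hq) hp
  simp only [dz_eta] at h
  rw [hL.Lc_low 0 k hp, hL.Lc_low 1 k hp, h]
  simp only [del, Fin.sum_univ_two]
  linear_combination (-Nc L 0 k p) * hL.de_de_eta 0 hp - Nc L 1 k p * hL.de_de_eta 1 hp

/-- The spray `Γ^i = N^i_k η^k`. -/
def spray (L : Pt 2 → ℂ) (i : Fin 2) (p : Pt 2) : ℂ :=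
  Nc L i 0 p * eta 0 p + Nc L i 1 p * eta 1 p

/-- `Γ^i L_i = η^k ∂_k L`. -/
def sprayLow (L : Pt 2 → ℂ) (p : Pt 2) : ℂ := dz L 0 p * eta 0 p + dz L 1 p * eta 1 p

lemma smooth_spray (hL : IsCFM 2 D L) (i : Fin 2) : ContDiffOn ℝ ∞ (spray L i) D :=
  ((hL.smooth_Nc i 0).mul (contDiff_eta 0)).add ((hL.smooth_Nc i 1).mul (contDiff_eta 1))

lemma smooth_sprayLow (hL : IsCFM 2 D L) : ContDiffOn ℝ ∞ (sprayLow L) D :=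
  ((hL.smooth_dz hL.smooth 0).mul (contDiff_eta 0)).add
    ((hL.smooth_dz hL.smooth 1).mul (contDiff_eta 1))

/-- `L_i L^i_{jk} η^k` in terms of the spray. -/
lemma Lc_low_eta_right (hL : IsCFM 2 D L) (j : Fin 2) {p : Pt 2} (hp : p ∈ D) :
    (Lc L 0 j 0 p * de L 0 p + Lc L 1 j 0 p * de L 1 p) * eta 0 p +
      (Lc L 0 j 1 p * de L 0 p + Lc L 1 j 1 p * de L 1 p) * eta 1 p =
      dz (de L j) 0 p * eta 0 p + dz (de L j) 1 p * eta 1 p -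
        (spray L 0 p * de (de L 0) j p + spray L 1 p * de (de L 1) j p) := by
  rw [hL.Lc_low j 0 hp, hL.Lc_low j 1 hp, hL.de_de_comm 0 j hp, hL.de_de_comm 1 j hp]
  simp only [del, Fin.sum_univ_two, spray]
  ring

section WeaklyKahler

/-- The weak Kähler condition, as an identity for the contractions of `L^i_{jk}`. -/
lemma weaklyKahler_Lc (hL : IsCFM 2 D L) (hwK : IsWeaklyKahler L D) (k : Fin 2) {p : Pt 2}
    (hp : p ∈ D) :
    (Lc L 0 k 0 p * de L 0 p + Lc L 1 k 0 p * de L 1 p) * eta 0 p +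
      (Lc L 0 k 1 p * de L 0 p + Lc L 1 k 1 p * de L 1 p) * eta 1 p = dz L k p := by
  have h := hwK p hp k
  rw [← hL.Lc_low_eta k hp, hL.gm_etab 0 hp, hL.gm_etab 1 hp]
  simp only [Fin.sum_univ_two] at h
  simp only [eta, etab]
  linear_combination -h

lemma weaklyKahler_spray (hL : IsCFM 2 D L) (hwK : IsWeaklyKahler L D) (k : Fin 2) {p : Pt 2}
    (hp : p ∈ D) :
    dz (de L k) 0 p * eta 0 p + dz (de L k) 1 p * eta 1 p =
      dz L k p + (spray L 0 p * de (de L 0) k p + spray L 1 p * de (de L 1) k p) := by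
  linear_combination hL.weaklyKahler_Lc hwK k hp - hL.Lc_low_eta_right k hp

lemma delbar_pairing_low (hL : IsCFM 2 D L) {f₀ f₁ : Pt 2 → ℂ} (hf₀ : ContDiffOn ℝ ∞ f₀ D)
    (hf₁ : ContDiffOn ℝ ∞ f₁ D) (h : Fin 2) {p : Pt 2} (hp : p ∈ D) :
    delbar L (fun q => f₀ q * de L 0 q + f₁ q * de L 1 q) h p =
      delbar L f₀ h p * de L 0 p + delbar L f₁ h p * de L 1 p := by
  have := (hL.isDer_delbar_s14 h).apply_pairing hf₀ hf₁ (hL.smooth_deL 0) (hL.smooth_deL 1)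
    (fun q _ => rfl) hp
  simp only [hL.delbar_deL _ _ hp] at this
  linear_combination this

lemma delbar_pairing_eta (hL : IsCFM 2 D L) {k f₀ f₁ : Pt 2 → ℂ} (hf₀ : ContDiffOn ℝ ∞ f₀ D)
    (hf₁ : ContDiffOn ℝ ∞ f₁ D) (hk : ∀ q ∈ D, k q = f₀ q * eta 0 q + f₁ q * eta 1 q)
    (h : Fin 2) {p : Pt 2} (hp : p ∈ D) :
    delbar L k h p = delbar L f₀ h p * eta 0 p + delbar L f₁ h p * eta 1 p := by
  have : delbar L k h p = _ := (hL.isDer_delbar_s14 h).apply_pairing hf₀ hf₁ (contDiff_eta 0)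
    (contDiff_eta 1) hk hp
  simp only [delbar_eta] at this
  linear_combination this

/-- `η̄^h δ_h̄(Γ^l) L_{kl} = 0`. -/
lemma weakSym_spray (hL : IsCFM 2 D L) (hwK : IsWeaklyKahler L D) (hsym : WeakSym L D)
    (k : Fin 2) {p : Pt 2} (hp : p ∈ D) :
    (delbar L (spray L 0) 0 p * etab 0 p + delbar L (spray L 0) 1 p * etab 1 p) *
        de (de L 0) k p +
      (delbar L (spray L 1) 0 p * etab 0 p + delbar L (spray L 1) 1 p * etab 1 p) *
        de (de L 1) k p = 0 := by
  have hs (j k : Fin 2) : ContDiffOn ℝ ∞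
      (fun q => Lc L 0 j k q * de L 0 q + Lc L 1 j k q * de L 1 q) D :=
    ((hL.smooth_Lc 0 j k).mul (hL.smooth_deL 0)).add ((hL.smooth_Lc 1 j k).mul (hL.smooth_deL 1))
  have h₁ (h : Fin 2) := hL.delbar_pairing_eta (hs 0 k) (hs 1 k)
    (fun q hq => (hL.Lc_low_eta k hq).symm) h hp
  have h₂ (h : Fin 2) := hL.delbar_pairing_eta (hs k 0) (hs k 1)
    (fun q hq => (hL.weaklyKahler_Lc hwK k hq).symm) h hp
  have hN (l h : Fin 2) := hL.delbar_pairing_eta (hL.smooth_Nc l 0) (hL.smooth_Nc l 1)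
    (k := spray L l) (fun _ _ => rfl) h hp
  simp only [fun j k h => hL.delbar_pairing_low (hL.smooth_Lc 0 j k) (hL.smooth_Lc 1 j k) h hp]
    at h₁ h₂
  have hkey := fun h => (h₁ h).symm.trans (h₂ h)
  have hC (j l : Fin 2) := hL.Cc_low j l hp
  have hE₀ := hL.de_de_eta 0 hp
  have hE₁ := hL.de_de_eta 1 hp
  have hw := hsym p hp k
  have hlow (x₀ x₁ : ℂ) : (gm L 0 0 p * x₀ + gm L 1 0 p * x₁) * etab 0 p +
      (gm L 0 1 p * x₀ + gm L 1 1 p * x₁) * etab 1 p = x₀ * de L 0 p + x₁ * de L 1 p := by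
    rw [hL.gm_etab 0 hp, hL.gm_etab 1 hp]
    ring
  have hR (j h k : Fin 2) : Rh L 0 j h k p * etab 0 p + Rh L 1 j h k p * etab 1 p =
      -(delbar L (Lc L 0 j k) h p * de L 0 p + delbar L (Lc L 1 j k) h p * de L 1 p) -
        (delbar L (Nc L 0 k) h p * de (de L j) 0 p + delbar L (Nc L 1 k) h p * de (de L j) 1 p) := by
    simp only [Rh, Fin.sum_univ_two, hlow]
    rw [← hC, ← hC]
    ring
  have hw' : (∑ h, ∑ s, (Rh L 0 k h s p * etab 0 p + Rh L 1 k h s p * etab 1 p) *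
      etab h p * eta s p) =
      ∑ h, ∑ s, (Rh L 0 s h k p * etab 0 p + Rh L 1 s h k p * etab 1 p) *
      etab h p * eta s p := by
    simp only [Fin.sum_univ_two] at hw ⊢
    simp only [eta, etab]
    linear_combination hw
  simp only [hR, Fin.sum_univ_two] at hw'
  simp only [hN]
  rw [hL.de_de_comm 0 k hp, hL.de_de_comm 1 k hp]
  linear_combination -hw' + etab 0 p * hkey 0 + etab 1 p * hkey 1 +
    (etab 0 p * delbar L (Nc L 0 k) 0 p + etab 1 p * delbar L (Nc L 0 k) 1 p) * hE₀ +
    (etab 0 p * delbar L (Nc L 1 k) 0 p + etab 1 p * delbar L (Nc L 1 k) 1 p) * hE₁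

/-- `L_{ik̄}Γ^i = ∂̇_k̄ (Γ^i L_i)`. -/
lemma debar_sprayLow (hL : IsCFM 2 D L) (k : Fin 2) {p : Pt 2} (hp : p ∈ D) :
    debar (sprayLow L) k p = spray L 0 p * gm L 0 k p + spray L 1 p * gm L 1 k p := by
  have h : debar (sprayLow L) k p = _ := ((isWd_debar k).isDer hL.openD).apply_pairing
    (hL.smooth_dz hL.smooth 0) (hL.smooth_dz hL.smooth 1) (contDiff_eta 0) (contDiff_eta 1)
    (fun q _ => rfl) hp
  have hc (j : Fin 2) : debar (dz L j) k p = dz (debar L k) j p :=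
    (isWd_debar k).comm hL.openD (isWd_dz j) hL.smooth hp
  simp only [debar_eta, hc, ← hL.Nc_gm _ k hp] at h
  simp only [spray]
  linear_combination h

lemma de_sprayLow (hL : IsCFM 2 D L) (hwK : IsWeaklyKahler L D) (k : Fin 2) {p : Pt 2}
    (hp : p ∈ D) :
    de (sprayLow L) k p = dz L k p + dz L k p +
      (spray L 0 p * de (de L 0) k p + spray L 1 p * de (de L 1) k p) := by
  have h : de (sprayLow L) k p = _ := ((isWd_de k).isDer hL.openD).apply_pairing
    (hL.smooth_dz hL.smooth 0) (hL.smooth_dz hL.smooth 1) (contDiff_eta 0) (contDiff_eta 1)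
    (fun q _ => rfl) hp
  have hc (j : Fin 2) : de (dz L j) k p = dz (de L k) j p :=
    (isWd_de k).comm hL.openD (isWd_dz j) hL.smooth hp
  simp only [hc, de_eta] at h
  have hw := hL.weaklyKahler_spray hwK k hp
  fin_cases k <;> simp at h hw ⊢ <;> linear_combination h + hw

/-- Differentiating `δ_h̄ L_i = 0` by a constant coefficient operator. -/
lemma delbar_apply_deL (hL : IsCFM 2 D L) {T : (Pt 2 → ℂ) → Pt 2 → ℂ} (hT : IsWd T)
    (i h : Fin 2) {p : Pt 2} (hp : p ∈ D) :
    delbar L (T (de L i)) h p =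
      T (fun q => (starRingEnd ℂ) (Nc L 0 h q)) p * gm L i 0 p +
        T (fun q => (starRingEnd ℂ) (Nc L 1 h q)) p * gm L i 1 p := by
  have h₁ := hL.apply_delbar hT (hL.smooth_deL i) h hp
  rw [(hT.isDer hL.openD).apply_zero (fun q hq => hL.delbar_deL i h hq) hp,
    hL.debar_de_s14 _ _ hp, hL.debar_de_s14 _ _ hp] at h₁
  linear_combination -h₁

/-- `η̄^h δ_h̄(Γ^i L_i)`. -/
def sprayCurv (L : Pt 2 → ℂ) (p : Pt 2) : ℂ :=
  delbar L (sprayLow L) 0 p * etab 0 p + delbar L (sprayLow L) 1 p * etab 1 p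

lemma de_sprayCurv (hL : IsCFM 2 D L) (hwK : IsWeaklyKahler L D) (hsym : WeakSym L D)
    (k : Fin 2) {p : Pt 2} (hp : p ∈ D) :
    de (sprayCurv L) k p =
      2 * (delbar L (dz L k) 0 p * etab 0 p + delbar L (dz L k) 1 p * etab 1 p) := by
  have hP := hL.smooth_sprayLow
  have h : de (sprayCurv L) k p = _ := ((isWd_de k).isDer hL.openD).apply_pairing
    (hL.smooth_delbar hP 0) (hL.smooth_delbar hP 1) (contDiff_etab 0) (contDiff_etab 1)
    (fun q _ => rfl) hp
  have hc (h : Fin 2) := hL.apply_delbar (isWd_de k) hP h hp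
  have hz := hL.smooth_dz hL.smooth k
  have hdd (i : Fin 2) := hL.smooth_de (hL.smooth_deL i) k
  have hsp := hL.smooth_spray
  have hd (h : Fin 2) : delbar L (de (sprayLow L) k) h p =
      2 * delbar L (dz L k) h p +
        ((delbar L (spray L 0) h p * de (de L 0) k p +
          spray L 0 p * delbar L (de (de L 0) k) h p) +
        (delbar L (spray L 1) h p * de (de L 1) k p +
          spray L 1 p * delbar L (de (de L 1) k) h p)) := by
    have h₁ : delbar L (de (sprayLow L) k) h p = _ := (hL.isDer_delbar_s14 h).apply_add
      (hz.add hz) (((hsp 0).mul (hdd 0)).add ((hsp 1).mul (hdd 1)))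
      (fun q hq => hL.de_sprayLow hwK k hq) hp
    have h₂ := (hL.isDer_delbar_s14 h).add _ _ hz hz p hp
    have h₃ := (hL.isDer_delbar_s14 h).apply_pairing (hsp 0) (hsp 1) (hdd 0) (hdd 1)
      (fun q _ => rfl) hp
    rw [h₁]
    exact (congrArg₂ (· + ·) h₂ h₃).trans (by ring)
  have hv (i h : Fin 2) := hL.delbar_apply_deL (isWd_de k) i h hp
  have hw := hL.weakSym_spray hwK hsym k hp
  simp only [hc, hd, hv, de_etab, hL.debar_sprayLow _ hp] at h
  linear_combination h + hw

lemma debar_sprayCurv (hL : IsCFM 2 D L) (k : Fin 2) {p : Pt 2} (hp : p ∈ D) :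
    debar (sprayCurv L) k p = delbar L (sprayLow L) k p +
      ((delbar L (spray L 0) 0 p * etab 0 p + delbar L (spray L 0) 1 p * etab 1 p) * gm L 0 k p +
      (delbar L (spray L 1) 0 p * etab 0 p + delbar L (spray L 1) 1 p * etab 1 p) *
        gm L 1 k p) := by
  have hP := hL.smooth_sprayLow
  have h : debar (sprayCurv L) k p = _ := ((isWd_debar k).isDer hL.openD).apply_pairing
    (hL.smooth_delbar hP 0) (hL.smooth_delbar hP 1) (contDiff_etab 0) (contDiff_etab 1)
    (fun q _ => rfl) hp
  have hc (h : Fin 2) := hL.apply_delbar (isWd_debar k) hP h hp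
  have hsp := hL.smooth_spray
  have hd (h : Fin 2) : delbar L (debar (sprayLow L) k) h p = _ :=
    (hL.isDer_delbar_s14 h).apply_pairing (hsp 0) (hsp 1) (hL.smooth_gm 0 k) (hL.smooth_gm 1 k)
      (fun q hq => hL.debar_sprayLow k hq) hp
  have hv (i h : Fin 2) : delbar L (gm L i k) h p = _ :=
    ((hL.isDer_delbar_s14 h).congr _ _ (fun q hq => (hL.debar_de_s14 i k hq).symm) p hp).trans
      (hL.delbar_apply_deL (isWd_debar k) i h hp)
  simp only [hc, hd, hv, debar_etab, hL.debar_sprayLow _ hp] at h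
  fin_cases k <;> simp at h ⊢ <;> linear_combination h

lemma delbar_dz (hL : IsCFM 2 D L) (k h : Fin 2) {p : Pt 2} (hp : p ∈ D) :
    delbar L (dz L k) h p = dzbar (dz L k) h p -
      ((starRingEnd ℂ) (Nc L 0 h p) * (Nc L 0 k p * gm L 0 0 p + Nc L 1 k p * gm L 1 0 p) +
        (starRingEnd ℂ) (Nc L 1 h p) * (Nc L 0 k p * gm L 0 1 p + Nc L 1 k p * gm L 1 1 p)) := by
  have hc (j : Fin 2) : debar (dz L k) j p = dz (debar L j) k p :=
    (isWd_debar j).comm hL.openD (isWd_dz k) hL.smooth hp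
  simp only [delbar, Fin.sum_univ_two, hc, hL.Nc_gm _ _ hp]

/-- `δ_h̄(∂_k L)` is Hermitian. -/
lemma conj_delbar_dz (hL : IsCFM 2 D L) (k h : Fin 2) {p : Pt 2} (hp : p ∈ D) :
    (starRingEnd ℂ) (delbar L (dz L k) h p) = delbar L (dz L h) k p := by
  have hz : (starRingEnd ℂ) (dzbar (dz L k) h p) = dzbar (dz L h) k p := by
    rw [conj_dzbar]
    have h₁ : dz (fun q => (starRingEnd ℂ) (dz L k q)) h p = dz (dzbar L k) h p := by
      refine ((isWd_dz h).isDer hL.openD).congr _ _ (fun q hq => ?_) p hp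
      rw [conj_dz]
      exact ((isWd_dzbar k).isDer hL.openD).congr _ _ (fun x hx => hL.conj_self hx) q hq
    rw [h₁]
    exact (isWd_dz h).comm hL.openD (isWd_dzbar k) hL.smooth hp
  rw [hL.delbar_dz k h hp, hL.delbar_dz h k hp]
  simp only [map_sub, map_add, map_mul, Complex.conj_conj, hz, hL.hermitian p hp]
  ring

lemma delbar_sprayLow (hL : IsCFM 2 D L) (h : Fin 2) {p : Pt 2} (hp : p ∈ D) :
    delbar L (sprayLow L) h p =
      delbar L (dz L 0) h p * eta 0 p + delbar L (dz L 1) h p * eta 1 p :=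
  hL.delbar_pairing_eta (hL.smooth_dz hL.smooth 0) (hL.smooth_dz hL.smooth 1)
    (fun _ _ => rfl) h hp

lemma conj_sprayCurv (hL : IsCFM 2 D L) {p : Pt 2} (hp : p ∈ D) :
    (starRingEnd ℂ) (sprayCurv L p) = sprayCurv L p := by
  have he (i : Fin 2) : (starRingEnd ℂ) (eta i p) = etab i p := rfl
  have he' (i : Fin 2) : (starRingEnd ℂ) (etab i p) = eta i p := Complex.conj_conj _
  simp only [sprayCurv, hL.delbar_sprayLow _ hp, map_add, map_mul, he, he',
    hL.conj_delbar_dz _ _ hp]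
  ring

/-- `δ_k̄(Γ^i L_i) = g_{ik̄} η̄^h δ_h̄(Γ^i)`. -/
lemma delbar_sprayLow_eq (hL : IsCFM 2 D L) (hwK : IsWeaklyKahler L D) (hsym : WeakSym L D)
    (k : Fin 2) {p : Pt 2} (hp : p ∈ D) :
    delbar L (sprayLow L) k p =
      (delbar L (spray L 0) 0 p * etab 0 p + delbar L (spray L 0) 1 p * etab 1 p) * gm L 0 k p +
      (delbar L (spray L 1) 0 p * etab 0 p + delbar L (spray L 1) 1 p * etab 1 p) *
        gm L 1 k p := by
  have he' (i : Fin 2) : (starRingEnd ℂ) (etab i p) = eta i p := Complex.conj_conj _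
  have h₁ : (starRingEnd ℂ) (de (sprayCurv L) k p) = debar (sprayCurv L) k p := by
    rw [conj_de]
    exact ((isWd_debar k).isDer hL.openD).congr _ _ (fun q hq => hL.conj_sprayCurv hq) p hp
  rw [hL.de_sprayCurv hwK hsym k hp, hL.debar_sprayCurv k hp] at h₁
  simp only [map_add, map_mul, hL.conj_delbar_dz _ _ hp, he', Complex.conj_ofNat] at h₁
  have h₂ := hL.delbar_sprayLow k hp
  linear_combination h₁ + 2 * h₂

end WeaklyKahler

section Frame

lemma Fh_ne_zero (hL : IsCFM 2 D L) {p : Pt 2} (hp : p ∈ D) : Fh L p ≠ 0 :=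
  Complex.ofReal_ne_zero.2 (Real.sqrt_pos.2 (hL.pos p hp)).ne'

lemma Fh_mul_self_s14 (hL : IsCFM 2 D L) {p : Pt 2} (hp : p ∈ D) : Fh L p * Fh L p = L p := by
  rw [Fh, ← Complex.ofReal_mul, Real.mul_self_sqrt (hL.pos p hp).le]
  exact Complex.conj_eq_iff_re.1 (hL.conj_self hp)

lemma smooth_Fh (hL : IsCFM 2 D L) : ContDiffOn ℝ ∞ (Fh L) D :=
  Complex.ofRealCLM.contDiff.comp_contDiffOn
    ((Complex.reCLM.contDiff.comp_contDiffOn hL.smooth).sqrt fun p hp => (hL.pos p hp).ne')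

lemma delbar_self (hL : IsCFM 2 D L) (k : Fin 2) {p : Pt 2} (hp : p ∈ D) :
    delbar L L k p = 0 := by
  rw [hL.delbar_pairing_eta (hL.smooth_deL 0) (hL.smooth_deL 1) (fun q hq => hL.euler_s14 hq) k hp,
    hL.delbar_deL _ _ hp, hL.delbar_deL _ _ hp]
  ring

lemma delbar_Fh (hL : IsCFM 2 D L) (k : Fin 2) {p : Pt 2} (hp : p ∈ D) :
    delbar L (Fh L) k p = 0 := by
  have h₁ := (hL.isDer_delbar_s14 k).mul _ _ hL.smooth_Fh hL.smooth_Fh p hp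
  have h₂ := (hL.isDer_delbar_s14 k).congr _ _ (fun q hq => hL.Fh_mul_self_s14 hq) p hp
  have h₃ : 2 * Fh L p * delbar L (Fh L) k p = 0 := by
    have := h₁.symm.trans (h₂.trans (hL.delbar_self k hp))
    linear_combination this
  simpa [hL.Fh_ne_zero hp] using h₃

lemma llow_eq_s14 (hL : IsCFM 2 D L) (i : Fin 2) {p : Pt 2} (hp : p ∈ D) :
    llow L i p = de L i p / Fh L p := by
  rw [hL.gm_etab i hp, llow, Fin.sum_univ_two]
  rfl

lemma sJ_mul_cube (hL : IsCFM 2 D L) {p : Pt 2} (hp : p ∈ D) :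
    sprayLow L p = sJ L p * (Fh L p * (Fh L p * Fh L p)) := by
  have hF := hL.Fh_ne_zero hp
  rw [sprayLow, ← hL.Lc_low_eta 0 hp, ← hL.Lc_low_eta 1 hp]
  simp only [sJ, Fin.sum_univ_two, lup, hL.llow_eq_s14 _ hp, eta]
  field_simp
  ring

lemma smooth_sJ (hL : IsCFM 2 D L) : ContDiffOn ℝ ∞ (sJ L) D := by
  have hF := hL.smooth_Fh
  refine (hL.smooth_sprayLow.mul ((hF.mul (hF.mul hF)).inv fun p hp => ?_)).congr fun p hp => ?_
  · simp [hL.Fh_ne_zero hp]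
  · exact (eq_div_of_mul_eq (by simp [hL.Fh_ne_zero hp]) (hL.sJ_mul_cube hp).symm).trans
      (div_eq_mul_inv _ _)

/-- `δ_k̄(J) = δ_k̄(Γ^i L_i) / F³`. -/
lemma delbar_sJ (hL : IsCFM 2 D L) (k : Fin 2) {p : Pt 2} (hp : p ∈ D) :
    delbar L (sJ L) k p * (Fh L p * (Fh L p * Fh L p)) = delbar L (sprayLow L) k p := by
  have hF := hL.smooth_Fh
  have hd := hL.isDer_delbar_s14 k
  have h₁ := hd.congr _ _ (fun q hq => hL.sJ_mul_cube hq) p hp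
  have h₂ := hd.mul _ _ hL.smooth_sJ (hF.mul (hF.mul hF)) p hp
  have h₃ := hd.mul _ _ hF (hF.mul hF) p hp
  have h₄ := hd.mul _ _ hF hF p hp
  simp only [hL.delbar_Fh k hp] at h₃ h₄
  refine Eq.symm (h₁.trans (h₂.trans ?_))
  refine (congrArg (fun x => _ + sJ L p * x)
    (h₃.trans (congrArg (fun x => _ + Fh L p * x) h₄))).trans ?_
  ring

lemma conj_mup (hL : IsCFM 2 D L) {p : Pt 2} (hp : p ∈ D) :
    (starRingEnd ℂ) (mup L 0 p) = -(debar L 1 p / Fh L p) / sg L p ∧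
      (starRingEnd ℂ) (mup L 1 p) = debar L 0 p / Fh L p / sg L p := by
  have hF : (starRingEnd ℂ) (Fh L p) = Fh L p := Complex.conj_ofReal _
  have hs : (starRingEnd ℂ) (sg L p) = sg L p := Complex.conj_ofReal _
  simp [mup, hL.llow_eq_s14 _ hp, hL.conj_de_self _ hp, hF, hs]

/-- `A` is a multiple of `m^j m^k L_{jk}`. -/
lemma sA_eq (hL : IsCFM 2 D L) {p : Pt 2} (hp : p ∈ D) :
    sA L p = (de L 1 p * de L 1 p * de (de L 0) 0 p - 2 * de L 0 p * de L 1 p * de (de L 0) 1 p +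
      de L 0 p * de L 0 p * de (de L 1) 1 p) / (Fh L p * Fh L p * Fh L p * sg L p * sg L p) := by
  have hC (j k : Fin 2) : de (de L j) k p = _ := (hL.Cc_low j k hp).symm
  have hsymm := hL.de_de_comm 1 0 hp
  rw [show 2 * de L 0 p * de L 1 p * de (de L 0) 1 p = de L 0 p * de L 1 p * de (de L 0) 1 p +
    de L 0 p * de L 1 p * de (de L 1) 0 p by rw [hsymm]; ring]
  simp only [hC, sA, Fin.sum_univ_two, mup, hL.llow_eq_s14 _ hp, if_true, one_ne_zero, if_false]
  ring

end Frame

end IsCFM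

end Metric

/-- weakly Kähler with the weak symmetry condition implies that at each
point either `A = 0` or `δ_s̄(J) m̄^s = 0`. -/
theorem statement14 (D : Set (Pt 2)) (L : Pt 2 → ℂ) (hL : IsCFM 2 D L)
    (hwK : IsWeaklyKahler L D) (hsym : WeakSym L D) :
    ∀ p ∈ D, sA L p = 0 ∨
      (∑ s, delbar L (sJ L) s p * (starRingEnd ℂ) (mup L s p)) = 0 := by
  intro p hp
  set φ₀ := delbar L (IsCFM.spray L 0) 0 p * etab 0 p + delbar L (IsCFM.spray L 0) 1 p * etab 1 p
  set φ₁ := delbar L (IsCFM.spray L 1) 0 p * etab 0 p + delbar L (IsCFM.spray L 1) 1 p * etab 1 p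
  have hφ (k : Fin 2) : φ₀ * de (de L 0) k p + φ₁ * de (de L 1) k p = 0 :=
    hL.weakSym_spray hwK hsym k hp
  have hη (k : Fin 2) := hL.de_de_eta k hp
  have hφ₀ := hφ 0
  have hη₀ := hη 0
  rw [hL.de_de_comm 1 0 hp] at hφ₀ hη₀
  have hA : sA L p * (φ₁ * eta 0 p - φ₀ * eta 1 p) = 0 := by
    rw [hL.sA_eq hp, div_mul_eq_mul_div]
    refine div_eq_zero_iff.2 (Or.inl ?_)
    linear_combination
      de L 1 p * de L 1 p * (φ₁ * hη₀ - eta 1 p * hφ₀) -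
      2 * de L 0 p * de L 1 p * (φ₁ * hη 1 - eta 1 p * hφ 1) +
      de L 0 p * de L 0 p * (eta 0 p * hφ 1 - φ₀ * hη 1)
  refine (mul_eq_zero.1 hA).imp_right fun hX => ?_
  have hF := hL.Fh_ne_zero hp
  have hQ (k : Fin 2) : delbar L (sJ L) k p * (Fh L p * (Fh L p * Fh L p)) =
      φ₀ * gm L 0 k p + φ₁ * gm L 1 k p :=
    (hL.delbar_sJ k hp).trans (hL.delbar_sprayLow_eq hwK hsym k hp)
  have hF3 : Fh L p * (Fh L p * Fh L p) ≠ 0 := by simp [hF]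
  refine (mul_eq_zero.1 (?_ : _ * (Fh L p * (Fh L p * Fh L p)) = 0)).resolve_right hF3
  rw [Fin.sum_univ_two, (hL.conj_mup hp).1, (hL.conj_mup hp).2, hL.gm_eta 0 hp, hL.gm_eta 1 hp]
  linear_combination
    (-((gm L 0 1 p * eta 0 p + gm L 1 1 p * eta 1 p) / Fh L p) / sg L p) * hQ 0 +
    ((gm L 0 0 p * eta 0 p + gm L 1 0 p * eta 1 p) / Fh L p / sg L p) * hQ 1 +
    ((gm L 0 0 p * gm L 1 1 p - gm L 0 1 p * gm L 1 0 p) / Fh L p / sg L p) * hX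

end CFinsler
end
end
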